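/- Let D ∈ {3,4,5} be an integer, let ν ∈ ℂ \ ℤ, and let z ∈ (−1,1) be real. Then the series Σ_{l=0}^∞ (2l+D−2)·P(z,l,D) / (ν(ν+D−2) − l(l+D−2)) converges (all denominators are nonzero since ν ∉ ℤ), and its sum equals (π/sin(πν)) · P(−z, ν, D). (Generalized Dougall formula.) -/

import Mathlib

open Filter

/-- Pochhammer symbol `(a)ₙ = a(a+1)⋯(a+n-1)` for complex `a`. -/
noncomputable def poch (a : ℂ) (n : ℕ) : ℂ := ∏ k ∈ Finset.range n, (a + k)

/-- Gauss hypergeometric series `₂F₁(a,b;c;x)`. -/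
noncomputable def F21 (a b c x : ℂ) : ℂ :=
  ∑' n : ℕ, poch a n * poch b n / (poch c n * n.factorial) * x ^ n

/-- `D`-dimensional Legendre (Gegenbauer) function `P(z, ν, D)`. -/
noncomputable def legP (z ν : ℂ) (D : ℕ) : ℂ :=
  Complex.Gamma (ν + D - 2) / (Complex.Gamma (ν + 1) * Complex.Gamma ((D : ℂ) - 1)) *
    F21 (-ν) (ν + (D : ℂ) - 2) (((D : ℂ) - 1) / 2) ((1 - z) / 2)

/-! ### The hypergeometric series -/

theorem poch_succ (a : ℂ) (n : ℕ) : poch a (n + 1) = poch a n * (a + n) := by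
  simp [poch, Finset.prod_range_succ]

theorem poch_succ_left (a : ℂ) (n : ℕ) : poch a (n + 1) = a * poch (a + 1) n := by
  simp only [poch, Finset.prod_range_succ', Nat.cast_zero, add_zero, Nat.cast_add, Nat.cast_one]
  rw [mul_comm]
  congr 1
  exact Finset.prod_congr rfl fun k _ => by ring

theorem poch_ne_zero {c : ℂ} (hc : ∀ n : ℕ, c + n ≠ 0) (n : ℕ) : poch c n ≠ 0 :=
  Finset.prod_ne_zero_iff.mpr fun k _ => hc k

/-- Taylor coefficients of the hypergeometric series. -/
noncomputable def hypCoeff (a b c : ℂ) (n : ℕ) : ℂ :=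
  poch a n * poch b n / (poch c n * n.factorial)

theorem hypCoeff_succ {a b c : ℂ} (hc : ∀ n : ℕ, c + n ≠ 0) (n : ℕ) :
    (n + 1) * (c + n) * hypCoeff a b c (n + 1) = (a + n) * (b + n) * hypCoeff a b c n := by
  have h1 := poch_ne_zero hc n
  have h2 := hc n
  have h3 : (n.factorial : ℂ) ≠ 0 := by exact_mod_cast n.factorial_ne_zero
  have h4 : (n : ℂ) + 1 ≠ 0 := by exact_mod_cast n.succ_ne_zero
  simp only [hypCoeff, poch_succ, Nat.factorial_succ]
  push_cast
  field_simp

theorem add_one_add_natCast_ne_zero {c : ℂ} (hc : ∀ n : ℕ, c + n ≠ 0) (n : ℕ) :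
    c + 1 + n ≠ 0 := by
  have := hc (n + 1)
  push_cast at this
  rwa [add_assoc, add_comm 1]

theorem hypCoeff_shift {a b c : ℂ} (hc : ∀ n : ℕ, c + n ≠ 0) (n : ℕ) :
    (n + 1) * hypCoeff a b c (n + 1) = a * b / c * hypCoeff (a + 1) (b + 1) (c + 1) n := by
  have h1 := poch_ne_zero (add_one_add_natCast_ne_zero hc) n
  have h2 : c ≠ 0 := by simpa using hc 0
  have h3 : (n.factorial : ℂ) ≠ 0 := by exact_mod_cast n.factorial_ne_zero
  have h4 : (n : ℂ) + 1 ≠ 0 := by exact_mod_cast n.succ_ne_zero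
  simp only [hypCoeff, poch_succ_left, Nat.factorial_succ]
  push_cast
  field_simp

theorem summable_hypCoeff {a b c : ℂ} (hc : ∀ n : ℕ, c + n ≠ 0) {x : ℂ} (hx : ‖x‖ < 1) :
    Summable fun n => hypCoeff a b c n * x ^ n := by
  obtain ⟨r, hr, hr1⟩ := exists_between hx
  refine summable_of_ratio_norm_eventually_le hr1 ?_
  have hlim : Tendsto (fun n : ℕ => (a + n) * (b + n) / ((n + 1) * (c + n)) * x) atTop
      (nhds (1 * 1 / (1 * 1) * x)) := by
    have key : ∀ d : ℂ, Tendsto (fun n : ℕ => (d + n) / (n : ℂ)) atTop (nhds 1) := by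
      intro d
      have h := (tendsto_const_div_atTop_nhds_zero_nat (𝕜 := ℂ) d).add_const 1
      rw [zero_add] at h
      refine h.congr' ?_
      filter_upwards [eventually_gt_atTop 0] with n hn
      have : (n : ℂ) ≠ 0 := by exact_mod_cast hn.ne'
      field_simp
    have h := ((((key a).mul (key b)).div ((key 1).mul (key c)) (by norm_num)).mul_const x)
    refine h.congr' ?_
    filter_upwards [eventually_gt_atTop 0] with n hn
    have h0 : (n : ℂ) ≠ 0 := by exact_mod_cast hn.ne'
    have h4 : (n : ℂ) + 1 ≠ 0 := by exact_mod_cast n.succ_ne_zero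
    have h2 := hc n
    simp only [Pi.div_apply, add_comm (1 : ℂ)]
    field_simp
  have hnorm := hlim.norm
  norm_num at hnorm
  filter_upwards [hnorm.eventually (gt_mem_nhds hr)] with n hn
  have h4 : (n : ℂ) + 1 ≠ 0 := by exact_mod_cast n.succ_ne_zero
  have h2 := hc n
  have e : hypCoeff a b c (n + 1) * x ^ (n + 1) =
      (a + n) * (b + n) / ((n + 1) * (c + n)) * x * (hypCoeff a b c n * x ^ n) := by
    have := hypCoeff_succ (a := a) (b := b) hc n
    field_simp
    linear_combination x ^ (n + 1) * this
  rw [e, norm_mul]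
  refine mul_le_mul_of_nonneg_right ?_ (norm_nonneg _)
  simpa using hn.le

theorem hasSum_F21 {a b c : ℂ} (hc : ∀ n : ℕ, c + n ≠ 0) {x : ℂ} (hx : ‖x‖ < 1) :
    HasSum (fun n => hypCoeff a b c n * x ^ n) (F21 a b c x) :=
  (summable_hypCoeff hc hx).hasSum

theorem F21_zero (a b c : ℂ) : F21 a b c 0 = 1 := by
  unfold F21
  rw [tsum_eq_single 0]
  · simp [poch]
  · intro n hn
    simp [hn]

theorem hasDerivAt_F21 {a b c : ℂ} (hc : ∀ n : ℕ, c + n ≠ 0) {x : ℂ} (hx : ‖x‖ < 1) :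
    HasDerivAt (F21 a b c) (a * b / c * F21 (a + 1) (b + 1) (c + 1) x) x := by
  obtain ⟨r, hr, hr1⟩ := exists_between hx
  have hr0 : 0 < r := (norm_nonneg x).trans_lt hr
  have hsum : Summable fun n : ℕ => ‖(n * hypCoeff a b c n) * (r : ℂ) ^ (n - 1)‖ := by
    rw [← summable_nat_add_iff 1]
    have h := (summable_hypCoeff (a := a + 1) (b := b + 1) (add_one_add_natCast_ne_zero hc)
      (x := r) (by simpa [abs_of_pos hr0] using hr1)).norm.mul_left ‖a * b / c‖
    refine h.congr fun n => ?_
    rw [← norm_mul, ← mul_assoc, ← hypCoeff_shift hc]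
    simp
  have hderiv := hasDerivAt_tsum_of_isPreconnected hsum (t := Metric.ball (0 : ℂ) r)
    (g := fun n y => hypCoeff a b c n * y ^ n)
    (g' := fun n y => (n * hypCoeff a b c n) * y ^ (n - 1)) (y₀ := 0) (y := x)
    Metric.isOpen_ball (convex_ball _ _).isPreconnected
    (fun n y _ => by
      refine ((hasDerivAt_pow n y).const_mul (hypCoeff a b c n)).congr_deriv ?_
      ring)
    (fun n y hy => by
      rw [norm_mul, norm_mul _ ((r : ℂ) ^ (n - 1)), norm_pow, norm_pow]
      refine mul_le_mul_of_nonneg_left (pow_le_pow_left₀ (norm_nonneg _) ?_ _) (norm_nonneg _)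
      rw [Complex.norm_real, Real.norm_of_nonneg hr0.le]
      exact (mem_ball_zero_iff.mp hy).le)
    (Metric.mem_ball_self hr0) (summable_hypCoeff hc (by simp)) (mem_ball_zero_iff.mpr hr)
  have h := ((hasSum_F21 (a := a + 1) (b := b + 1)
    (add_one_add_natCast_ne_zero hc) hx).mul_left (a * b / c))
  have hval : HasSum (fun n : ℕ => (n * hypCoeff a b c n) * x ^ (n - 1))
      (a * b / c * F21 (a + 1) (b + 1) (c + 1) x) := by
    rw [← hasSum_nat_add_iff' 1]
    simp only [Finset.range_one, Finset.sum_singleton, Nat.cast_zero, zero_mul, sub_zero]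
    refine h.congr_fun fun n => ?_
    rw [← mul_assoc, ← hypCoeff_shift hc]
    simp
  rw [← hval.tsum_eq]
  exact hderiv

/-- The hypergeometric differential equation. -/
theorem F21_ode {a b c : ℂ} (hc : ∀ n : ℕ, c + n ≠ 0) {x : ℂ} (hx : ‖x‖ < 1) :
    x * (1 - x) * (a * b / c *
        ((a + 1) * (b + 1) / (c + 1) * F21 (a + 1 + 1) (b + 1 + 1) (c + 1 + 1) x)) +
      (c - (a + b + 1) * x) * (a * b / c * F21 (a + 1) (b + 1) (c + 1) x) -
      a * b * F21 a b c x = 0 := by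
  have hc1 := add_one_add_natCast_ne_zero hc
  have h0 := hasSum_F21 (a := a) (b := b) hc hx
  have h1 : HasSum (fun n : ℕ => (n + 1) * hypCoeff a b c (n + 1) * x ^ n)
      (a * b / c * F21 (a + 1) (b + 1) (c + 1) x) := by
    refine ((hasSum_F21 (a := a + 1) (b := b + 1) hc1 hx).mul_left (a * b / c)).congr_fun ?_
    intro n
    rw [← mul_assoc, ← hypCoeff_shift hc]
  have h2 : HasSum (fun n : ℕ => (n + 1) * ((n + 2) * hypCoeff a b c (n + 2)) * x ^ n)
      (a * b / c *
        ((a + 1) * (b + 1) / (c + 1) * F21 (a + 1 + 1) (b + 1 + 1) (c + 1 + 1) x)) := by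
    refine (((hasSum_F21 (a := a + 1 + 1) (b := b + 1 + 1)
      (add_one_add_natCast_ne_zero hc1) hx).mul_left
        ((a + 1) * (b + 1) / (c + 1))).mul_left (a * b / c)).congr_fun ?_
    intro n
    have e1 := hypCoeff_shift (a := a) (b := b) hc (n + 1)
    have e2 := hypCoeff_shift (a := a + 1) (b := b + 1) hc1 n
    push_cast at e1
    linear_combination (n + 1) * x ^ n * e1 + (a * b / c) * x ^ n * e2
  have h1x : HasSum (fun n : ℕ => n * hypCoeff a b c n * x ^ n)
      (x * (a * b / c * F21 (a + 1) (b + 1) (c + 1) x)) := by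
    rw [← hasSum_nat_add_iff' 1]
    simp only [Finset.range_one, Finset.sum_singleton, Nat.cast_zero, zero_mul, sub_zero]
    refine (h1.mul_left x).congr_fun fun n => ?_
    push_cast
    ring
  have h2x : HasSum (fun n : ℕ => n * ((n + 1) * hypCoeff a b c (n + 1)) * x ^ n)
      (x * (a * b / c *
        ((a + 1) * (b + 1) / (c + 1) * F21 (a + 1 + 1) (b + 1 + 1) (c + 1 + 1) x))) := by
    rw [← hasSum_nat_add_iff' 1]
    simp only [Finset.range_one, Finset.sum_singleton, Nat.cast_zero, zero_mul, sub_zero]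
    refine (h2.mul_left x).congr_fun fun n => ?_
    push_cast
    ring
  have h2xx : HasSum (fun n : ℕ => n * (n - 1) * hypCoeff a b c n * x ^ n)
      (x * (x * (a * b / c *
        ((a + 1) * (b + 1) / (c + 1) * F21 (a + 1 + 1) (b + 1 + 1) (c + 1 + 1) x)))) := by
    rw [← hasSum_nat_add_iff' 1]
    simp only [Finset.range_one, Finset.sum_singleton, Nat.cast_zero, zero_mul, sub_zero]
    refine (h2x.mul_left x).congr_fun fun n => ?_
    push_cast
    ring
  have hall := ((((h2x.sub h2xx).add (h1.mul_left c)).sub (h1x.mul_left (a + b + 1))).sub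
    (h0.mul_left (a * b)))
  have hzero := (hall.congr_fun (g := fun _ => 0) fun n => by
    linear_combination -x ^ n * hypCoeff_succ (a := a) (b := b) hc n).unique hasSum_zero
  linear_combination hzero

/-! ### A Grönwall estimate for singular second-order equations -/

theorem norm_le_of_hasDerivAt_Ioo {f f' : ℝ → ℂ} {B B' : ℝ → ℝ} {T : ℝ}
    (hf : ContinuousOn f (Set.Icc 0 T)) (hf' : ∀ x ∈ Set.Ioo 0 T, HasDerivAt f (f' x) x)
    (h0 : f 0 = 0) (hB : ∀ x, HasDerivAt B (B' x) x) (hB0 : B 0 = 0)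
    (bound : ∀ x ∈ Set.Ioo 0 T, ‖f' x‖ ≤ B' x) : ∀ x ∈ Set.Icc 0 T, ‖f x‖ ≤ B x := by
  rintro x ⟨hx0, hxT⟩
  rcases hx0.eq_or_lt with rfl | hx0
  · simp [h0, hB0]
  have key : ∀ δ ∈ Set.Ioo 0 x, ‖f x - f δ‖ ≤ B x - B δ := by
    rintro δ ⟨hδ, hδx⟩
    refine image_norm_le_of_norm_deriv_right_le_deriv_boundary (a := δ) (b := x)
      (f := fun y => f y - f δ) (f' := f') (B := fun y => B y - B δ) (B' := B')
      ?_ ?_ (by simp) (fun y => (hB y).sub_const _) ?_ (Set.right_mem_Icc.mpr hδx.le)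
    · exact (hf.mono (Set.Icc_subset_Icc hδ.le hxT)).sub continuousOn_const
    · intro y hy
      exact ((hf' y ⟨hδ.trans_le hy.1, hy.2.trans_le hxT⟩).sub_const _).hasDerivWithinAt
    · intro y hy
      exact bound y ⟨hδ.trans_le hy.1, hy.2.trans_le hxT⟩
  have hf0 : Tendsto f (nhdsWithin 0 (Set.Ioo 0 x)) (nhds (f 0)) :=
    (hf 0 ⟨le_rfl, hx0.le.trans hxT⟩).mono_left
      (nhdsWithin_mono _ fun y hy => ⟨hy.1.le, hy.2.le.trans hxT⟩)
  have hB0' : Tendsto B (nhdsWithin 0 (Set.Ioo 0 x)) (nhds (B 0)) :=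
    (hB 0).continuousAt.tendsto.mono_left nhdsWithin_le_nhds
  have : (nhdsWithin (0 : ℝ) (Set.Ioo 0 x)).NeBot := by
    rw [nhdsWithin_Ioo_eq_nhdsGT hx0]
    infer_instance
  have := le_of_tendsto_of_tendsto (tendsto_const_nhds.sub hf0).norm (tendsto_const_nhds.sub hB0')
    (eventually_nhdsWithin_of_forall key)
  simpa [h0, hB0] using this

theorem norm_le_of_singular_system {u v v' w R : ℝ → ℂ} {T C L ε : ℝ} (hT : 0 ≤ T) (hC : 0 ≤ C)
    (hL : 0 ≤ L) (hu : ContinuousOn u (Set.Icc 0 T)) (hv : ContinuousOn v (Set.Icc 0 T))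
    (hR : ContinuousOn R (Set.Icc 0 T)) (hu0 : u 0 = 0) (hv0 : v 0 = 0) (hR0 : R 0 = 0)
    (hv' : ∀ t ∈ Set.Ioo 0 T, HasDerivAt v (v' t) t)
    (hv'b : ∀ t ∈ Set.Ioo 0 T, ‖v' t‖ ≤ L * ‖u t‖)
    (hw : ∀ t ∈ Set.Ioo 0 T, HasDerivAt (fun s => u s - R s) (w t) t)
    (hwb : ∀ t ∈ Set.Ioo 0 T, ‖w t‖ * t ≤ C * ‖v t‖)
    (hRb : ∀ t ∈ Set.Icc 0 T, ‖R t‖ ≤ ε) :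
    ∀ t ∈ Set.Icc 0 T, ‖u t‖ ≤ 2 * ε * Real.exp ((2 * (C * L) + 1) * T) ∧
      ‖v t‖ ≤ L * (2 * ε * Real.exp ((2 * (C * L) + 1) * T)) * T := by
  set K : ℝ := 2 * (C * L) + 1 with hK
  have hK0 : 0 < K := by positivity
  have hexp : ∀ k x : ℝ, HasDerivAt (fun s => Real.exp (k * s)) (k * Real.exp (k * x)) x := by
    intro k x
    simpa [mul_comm] using ((hasDerivAt_id x).const_mul k).exp
  obtain ⟨p, hp, hpmax⟩ := isCompact_Icc.exists_isMaxOn (Set.nonempty_Icc.mpr hT)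
    (f := fun t => ‖u t‖ * Real.exp (-K * t)) (hu.norm.mul (by fun_prop))
  set m : ℝ := ‖u p‖ * Real.exp (-K * p) with hm
  have hm0 : 0 ≤ m := by positivity
  have hum : ∀ t ∈ Set.Icc 0 T, ‖u t‖ ≤ m * Real.exp (K * t) := by
    intro t ht
    have h : ‖u t‖ * Real.exp (-K * t) ≤ m := hpmax ht
    calc ‖u t‖ = ‖u t‖ * Real.exp (-K * t) * Real.exp (K * t) := by
          rw [mul_assoc, ← Real.exp_add]; simp
      _ ≤ _ := mul_le_mul_of_nonneg_right h (Real.exp_pos _).le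
  have hvm : ∀ M : ℝ, ∀ x ∈ Set.Icc 0 T, (∀ s ∈ Set.Ioo 0 x, ‖u s‖ ≤ M) → ‖v x‖ ≤ L * M * x := by
    intro M x hx hM
    refine norm_le_of_hasDerivAt_Ioo (f' := v') (B := fun s => L * M * s) (B' := fun _ => L * M)
      (hv.mono (Set.Icc_subset_Icc_right hx.2))
      (fun y hy => hv' y ⟨hy.1, hy.2.trans_le hx.2⟩) hv0
      (fun y => by simpa using (hasDerivAt_id y).const_mul (L * M)) (by simp)
      (fun y hy => (hv'b y ⟨hy.1, hy.2.trans_le hx.2⟩).trans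
        (mul_le_mul_of_nonneg_left (hM y hy) hL)) x ⟨hx.1, le_rfl⟩
  have hwm : ∀ x ∈ Set.Ioo 0 T, ‖w x‖ ≤ C * L * m * Real.exp (K * x) := by
    intro x hx
    have h1 := hvm (m * Real.exp (K * x)) x ⟨hx.1.le, hx.2.le⟩ fun s hs =>
      (hum s ⟨hs.1.le, hs.2.le.trans hx.2.le⟩).trans <| by
        have := hs.2.le
        gcongr
    have h2 := (hwb x hx).trans (mul_le_mul_of_nonneg_left h1 hC)
    refine le_of_mul_le_mul_right (h2.trans_eq ?_) hx.1
    ring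
  have hdiff := norm_le_of_hasDerivAt_Ioo (T := T) (f := fun s => u s - R s) (f' := w)
    (B := fun s => C * L * m / K * (Real.exp (K * s) - 1))
    (B' := fun s => C * L * m / K * (K * Real.exp (K * s)))
    (hu.sub hR) hw (by simp [hu0, hR0]) (fun x => ((hexp K x).sub_const 1).const_mul _)
    (by simp) (fun x hx => (hwm x hx).trans_eq (by field_simp))
  have hmε : m ≤ 2 * ε := by
    have h1 := hdiff p hp
    have h2 : ‖u p‖ ≤ ε + C * L * m / K * (Real.exp (K * p) - 1) := by
      have h3 := norm_le_norm_sub_add (u p) (R p)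
      have h4 := hRb p hp
      linarith
    have h5 : C * L * m / K ≤ m / 2 := by
      rw [div_le_div_iff₀ hK0 two_pos]
      nlinarith
    have h6 : 1 ≤ Real.exp (K * p) := Real.one_le_exp (mul_nonneg hK0.le hp.1)
    have h7 : ‖u p‖ = m * Real.exp (K * p) := by
      rw [hm, mul_assoc, ← Real.exp_add]; simp
    have h8 : C * L * m / K * (Real.exp (K * p) - 1) ≤ m / 2 * (Real.exp (K * p) - 1) :=
      mul_le_mul_of_nonneg_right h5 (by linarith)
    nlinarith
  have huT : ∀ t ∈ Set.Icc 0 T, ‖u t‖ ≤ 2 * ε * Real.exp (K * T) := fun t ht =>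
    (hum t ht).trans <| mul_le_mul hmε
      (Real.exp_le_exp.mpr (mul_le_mul_of_nonneg_left ht.2 hK0.le)) (Real.exp_pos _).le
      (hm0.trans hmε)
  refine fun t ht => ⟨huT t ht, ?_⟩
  refine (hvm _ t ht fun s hs => huT s ⟨hs.1.le, hs.2.le.trans ht.2⟩).trans ?_
  exact mul_le_mul_of_nonneg_left ht.2
    (mul_nonneg hL (mul_nonneg (hm0.trans hmε) (Real.exp_pos _).le))

/-! ### Shifted Legendre polynomials -/

/-- The Legendre polynomials in the variable `t = (1 - x) / 2`. -/
noncomputable def legQ : ℕ → ℝ → ℝ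
  | 0, _ => 1
  | 1, t => 1 - 2 * t
  | n + 2, t => ((2 * n + 3) * (1 - 2 * t) * legQ (n + 1) t - (n + 1) * legQ n t) / (n + 2)

/-- The derivative of `legQ`. -/
noncomputable def dlegQ : ℕ → ℝ → ℝ
  | 0, _ => 0
  | 1, _ => -2
  | n + 2, t => ((2 * n + 3) * (-2 * legQ (n + 1) t + (1 - 2 * t) * dlegQ (n + 1) t) -
      (n + 1) * dlegQ n t) / (n + 2)

theorem legQ_rec (n : ℕ) (t : ℝ) :
    (n + 2) * legQ (n + 2) t =
      (2 * n + 3) * (1 - 2 * t) * legQ (n + 1) t - (n + 1) * legQ n t := by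
  rw [legQ]
  field_simp

theorem dlegQ_rec (n : ℕ) (t : ℝ) :
    (n + 2) * dlegQ (n + 2) t =
      (2 * n + 3) * (-2 * legQ (n + 1) t + (1 - 2 * t) * dlegQ (n + 1) t) -
        (n + 1) * dlegQ n t := by
  rw [dlegQ]
  field_simp

theorem hasDerivAt_legQ (n : ℕ) (t : ℝ) : HasDerivAt (legQ n) (dlegQ n t) t := by
  have hlin : HasDerivAt (fun s : ℝ => 1 - 2 * s) (-2) t := by
    simpa using ((hasDerivAt_id t).const_mul 2).const_sub 1
  induction n using Nat.twoStepInduction with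
  | zero => exact hasDerivAt_const t 1
  | one => exact hlin
  | more n h0 h1 =>
    have h := ((((hlin.const_mul (2 * (n : ℝ) + 3)).mul h1).sub
      (h0.const_mul ((n : ℝ) + 1))).div_const ((n : ℝ) + 2))
    refine h.congr_deriv ?_
    rw [dlegQ]
    ring

theorem dlegQ_succ_pair (n : ℕ) (t : ℝ) :
    dlegQ (n + 1) t = (1 - 2 * t) * dlegQ n t - 2 * (n + 1) * legQ n t ∧
      (1 - 2 * t) * dlegQ (n + 1) t - dlegQ n t = -2 * (n + 1) * legQ (n + 1) t := by
  induction n with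
  | zero => simp [dlegQ, legQ]; ring
  | succ n ih =>
    obtain ⟨hA, hB⟩ := ih
    have hrec := legQ_rec n t
    have hdrec := dlegQ_rec n t
    have hn : (n : ℝ) + 2 ≠ 0 := by positivity
    have hA' : dlegQ (n + 2) t =
        (1 - 2 * t) * dlegQ (n + 1) t - 2 * (n + 2) * legQ (n + 1) t := by
      apply mul_left_cancel₀ hn
      linear_combination hdrec + (n + 1) * hB
    push_cast
    refine ⟨by linear_combination hA', ?_⟩
    linear_combination (1 - 2 * t) * hA' + (1 - 2 * t) * hB - hA + 2 * hrec

theorem mul_dlegQ_succ (n : ℕ) (t : ℝ) :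
    2 * (t * (1 - t) * dlegQ (n + 1) t) =
      (n + 1) * ((1 - 2 * t) * legQ (n + 1) t - legQ n t) := by
  obtain ⟨hA, hB⟩ := dlegQ_succ_pair n t
  linear_combination (-(1 - 2 * t) / 2) * hB + hA / 2

theorem hasDerivAt_mul_dlegQ (n : ℕ) (t : ℝ) :
    HasDerivAt (fun s => s * (1 - s) * dlegQ n s) (-(n * (n + 1)) * legQ n t) t := by
  cases n with
  | zero => simpa [dlegQ] using hasDerivAt_const t (0 : ℝ)
  | succ n =>
    have hlin : HasDerivAt (fun s : ℝ => 1 - 2 * s) (-2) t := by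
      simpa using ((hasDerivAt_id t).const_mul 2).const_sub 1
    have h := (((hlin.mul (hasDerivAt_legQ (n + 1) t)).sub (hasDerivAt_legQ n t)).const_mul
      (((n : ℝ) + 1) / 2))
    have e : (fun s => s * (1 - s) * dlegQ (n + 1) s) = fun s : ℝ =>
        ((n : ℝ) + 1) / 2 * ((1 - 2 * s) * legQ (n + 1) s - legQ n s) := by
      funext s
      linear_combination mul_dlegQ_succ n s / 2
    rw [e]
    refine h.congr_deriv ?_
    push_cast
    linear_combination ((n : ℝ) + 1) / 2 * (dlegQ_succ_pair n t).2

theorem legQ_zero_right (n : ℕ) : legQ n 0 = 1 := by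
  induction n using Nat.twoStepInduction with
  | zero => simp [legQ]
  | one => simp [legQ]
  | more n h0 h1 =>
    rw [legQ, h0, h1]
    field_simp
    ring

theorem legQ_one_sub (n : ℕ) (t : ℝ) : legQ n (1 - t) = (-1) ^ n * legQ n t := by
  induction n using Nat.twoStepInduction with
  | zero => simp [legQ]
  | one => simp [legQ]; ring
  | more n h0 h1 =>
    rw [legQ, legQ, h0, h1]
    ring

theorem dlegQ_one_sub (n : ℕ) (t : ℝ) : dlegQ n (1 - t) = -(-1) ^ n * dlegQ n t := by
  induction n using Nat.twoStepInduction with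
  | zero => simp [dlegQ]
  | one => simp [dlegQ]
  | more n h0 h1 =>
    rw [dlegQ, dlegQ, h0, h1, legQ_one_sub]
    ring

theorem sum_legQ (N : ℕ) (t : ℝ) :
    ∑ l ∈ Finset.range (N + 1), (-1) ^ l * (2 * l + 1) * legQ l t =
      (-1) ^ N * (dlegQ N t - dlegQ (N + 1) t) / 2 := by
  induction N with
  | zero => simp [legQ, dlegQ]
  | succ N ih =>
    rw [Finset.sum_range_succ, ih]
    have hA := (dlegQ_succ_pair (N + 1) t).1
    have hB := (dlegQ_succ_pair N t).2
    push_cast at hA ⊢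
    rw [pow_succ]
    linear_combination (-1) ^ N * (-hA - hB) / 2

theorem legQ_energy_succ (n : ℕ) (t : ℝ) :
    (legQ (n + 1) t - (1 - 2 * t) * legQ (n + 2) t) ^ 2 +
        4 * (t * (1 - t)) * legQ (n + 2) t ^ 2 =
      ((n + 1) / (n + 2)) ^ 2 * (legQ n t - (1 - 2 * t) * legQ (n + 1) t) ^ 2 +
        4 * (t * (1 - t)) * legQ (n + 1) t ^ 2 := by
  rw [legQ]
  field_simp
  ring

/-- A discrete energy controlling two consecutive Legendre polynomials. -/
noncomputable def legEnergy (n : ℕ) (t : ℝ) : ℝ :=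
  (legQ n t - (1 - 2 * t) * legQ (n + 1) t) ^ 2 + 4 * (t * (1 - t)) * legQ (n + 1) t ^ 2

theorem legEnergy_succ (n : ℕ) (t : ℝ) :
    legEnergy (n + 1) t = legEnergy n t - (1 - ((n + 1 : ℝ) / (n + 2)) ^ 2) *
      (legQ n t - (1 - 2 * t) * legQ (n + 1) t) ^ 2 := by
  simp only [legEnergy]
  rw [legQ_energy_succ]
  ring

theorem ratio_sq_bound (n : ℕ) : 1 / ((n : ℝ) + 2) ≤ 1 - ((n + 1 : ℝ) / (n + 2)) ^ 2 := by
  rw [div_pow, div_le_iff₀ (by positivity), sub_mul, one_mul,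
    show ((n : ℝ) + 1) ^ 2 / (n + 2) ^ 2 * (n + 2) = (n + 1) ^ 2 / (n + 2) by field_simp,
    le_sub_iff_add_le, ← le_sub_iff_add_le', div_le_iff₀ (by positivity)]
  nlinarith [(Nat.cast_nonneg n : (0 : ℝ) ≤ n)]

theorem legEnergy_antitone (t : ℝ) : Antitone fun n => legEnergy n t := by
  refine antitone_nat_of_succ_le fun n => ?_
  rw [legEnergy_succ]
  have h : 0 ≤ 1 - ((n + 1 : ℝ) / (n + 2)) ^ 2 := le_trans (by positivity) (ratio_sq_bound n)
  nlinarith [mul_nonneg h (sq_nonneg (legQ n t - (1 - 2 * t) * legQ (n + 1) t))]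

theorem legEnergy_le (n : ℕ) (t : ℝ) : legEnergy n t ≤ 4 * (t * (1 - t)) := by
  refine (legEnergy_antitone t (Nat.zero_le n)).trans_eq ?_
  simp only [legEnergy, legQ]
  ring

theorem abs_legQ_le_one {t : ℝ} (ht : t ∈ Set.Ioo (0 : ℝ) 1) (n : ℕ) : |legQ n t| ≤ 1 := by
  cases n with
  | zero => simp [legQ]
  | succ n =>
    have h := legEnergy_le n t
    have hpos : 0 < t * (1 - t) := mul_pos ht.1 (sub_pos.mpr ht.2)
    rw [← sq_le_one_iff_abs_le_one]
    simp only [legEnergy] at h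
    nlinarith [sq_nonneg (legQ n t - (1 - 2 * t) * legQ (n + 1) t)]

theorem abs_legQ_sub_le {t : ℝ} (ht : t ∈ Set.Ioo (0 : ℝ) 1) (n : ℕ) :
    |legQ n t - legQ (n + 1) t| ≤ 4 * √t := by
  have h := legEnergy_le n t
  have hpos : 0 < t * (1 - t) := mul_pos ht.1 (sub_pos.mpr ht.2)
  simp only [legEnergy] at h
  have hs : √t ^ 2 = t := Real.sq_sqrt ht.1.le
  have h1 : |legQ n t - (1 - 2 * t) * legQ (n + 1) t| ≤ 2 * √t := by
    refine abs_le_of_sq_le_sq ?_ (by positivity)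
    nlinarith [mul_nonneg hpos.le (sq_nonneg (legQ (n + 1) t)), sq_nonneg t]
  have h2 := abs_legQ_le_one ht (n + 1)
  have h3 : t ≤ √t := by
    rw [Real.le_sqrt ht.1.le ht.1.le]
    nlinarith [ht.1, ht.2]
  have e : legQ n t - legQ (n + 1) t =
      (legQ n t - (1 - 2 * t) * legQ (n + 1) t) + (-2 * t) * legQ (n + 1) t := by ring
  rw [e]
  refine (abs_add_le _ _).trans ?_
  rw [abs_mul, abs_mul, abs_of_pos ht.1]
  norm_num
  nlinarith [ht.1, abs_nonneg (legQ (n + 1) t)]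

theorem tendsto_legEnergy {t : ℝ} (ht : t ∈ Set.Ioo (0 : ℝ) 1) :
    Tendsto (fun n => legEnergy n t) atTop (nhds 0) := by
  set q : ℝ := 4 * (t * (1 - t)) with hq
  have hqpos : 0 < q := by
    have := mul_pos ht.1 (sub_pos.mpr ht.2)
    positivity
  have hq1 : q ≤ 1 := by nlinarith [sq_nonneg (1 - 2 * t)]
  set d : ℕ → ℝ := fun n => legQ n t - (1 - 2 * t) * legQ (n + 1) t with hd
  have hnonneg : ∀ n, 0 ≤ legEnergy n t := fun n => by
    have : 0 ≤ t * (1 - t) := mul_nonneg ht.1.le (sub_nonneg.mpr ht.2.le)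
    unfold legEnergy
    positivity
  have hdecr : ∀ n : ℕ, d n ^ 2 / (n + 2) ≤ legEnergy n t - legEnergy (n + 1) t := by
    intro n
    rw [legEnergy_succ]
    have := mul_le_mul_of_nonneg_right (ratio_sq_bound n) (sq_nonneg (d n))
    have e : d n ^ 2 / ((n : ℝ) + 2) = 1 / ((n : ℝ) + 2) * d n ^ 2 := by ring
    rw [e]
    linarith
  have hctrl : ∀ n : ℕ, q * legEnergy (n + 1) t ≤ 3 * (d n ^ 2 + d (n + 1) ^ 2) := by
    intro n
    have h1 : q * legQ (n + 1) t =
        d (n + 1) - (1 - 2 * t) * (((n : ℝ) + 1) / (n + 2)) * (-1) * (-1) * d n := by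
      simp only [hd, hq, legQ]
      field_simp
      ring
    set k : ℝ := (1 - 2 * t) * (((n : ℝ) + 1) / (n + 2)) * (-1) * (-1) with hk
    have hr1 : (((n : ℝ) + 1) / (n + 2)) ^ 2 ≤ 1 := by
      rw [sq_le_one_iff₀ (by positivity), div_le_one (by positivity)]
      linarith
    have hk1 : k ^ 2 ≤ 1 := by
      have : k ^ 2 = (1 - 2 * t) ^ 2 * (((n : ℝ) + 1) / (n + 2)) ^ 2 := by rw [hk]; ring
      rw [this]
      refine mul_le_one₀ ?_ (sq_nonneg _) hr1
      nlinarith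
    have h2 : legEnergy (n + 1) t =
        (((n : ℝ) + 1) / (n + 2)) ^ 2 * d n ^ 2 + q * legQ (n + 1) t ^ 2 :=
      legQ_energy_succ n t
    have h3 : q * legEnergy (n + 1) t =
        q * (((n : ℝ) + 1) / (n + 2)) ^ 2 * d n ^ 2 + (d (n + 1) - k * d n) ^ 2 := by
      rw [h2, ← h1]
      ring
    have h4 : q * (((n : ℝ) + 1) / (n + 2)) ^ 2 ≤ 1 := mul_le_one₀ hq1 (sq_nonneg _) hr1
    have h5 : (d (n + 1) - k * d n) ^ 2 ≤ 2 * d (n + 1) ^ 2 + 2 * (k ^ 2 * d n ^ 2) := by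
      nlinarith [sq_nonneg (d (n + 1) + k * d n)]
    have h6 := mul_le_mul_of_nonneg_right h4 (sq_nonneg (d n))
    have h7 := mul_le_mul_of_nonneg_right hk1 (sq_nonneg (d n))
    rw [h3]
    nlinarith [sq_nonneg (d (n + 1))]
  have hbdd : BddBelow (Set.range fun n => legEnergy n t) :=
    ⟨0, by rintro _ ⟨n, rfl⟩; exact hnonneg n⟩
  have hlim := tendsto_atTop_ciInf (legEnergy_antitone t) hbdd
  set e : ℝ := ⨅ n, legEnergy n t with he
  have hele : ∀ n, e ≤ legEnergy n t := fun n => ciInf_le hbdd n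
  have he0 : 0 ≤ e := le_ciInf hnonneg
  suffices e = 0 by rwa [this] at hlim
  by_contra hne
  have hepos : 0 < e := lt_of_le_of_ne he0 (Ne.symm hne)
  have hstep : ∀ n : ℕ, q * e / 3 / ((n : ℝ) + 3) ≤ legEnergy n t - legEnergy (n + 2) t := by
    intro n
    have h1 := hdecr n
    have h2 := hdecr (n + 1)
    have h3 := hctrl n
    have h4 := mul_le_mul_of_nonneg_left (hele (n + 1)) hqpos.le
    have h5 : d n ^ 2 / ((n : ℝ) + 3) ≤ d n ^ 2 / (n + 2) := by
      gcongr
      linarith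
    push_cast at h2
    have h6 : (n : ℝ) + 1 + 2 = n + 3 := by ring
    rw [h6] at h2
    have h7 : q * e / 3 / ((n : ℝ) + 3) ≤ (d n ^ 2 + d (n + 1) ^ 2) / (n + 3) := by
      gcongr
      linarith
    rw [add_div] at h7
    have h8 : legEnergy (n + 1 + 1) t = legEnergy (n + 2) t := rfl
    linarith
  have hsum : ∀ N : ℕ, ∑ n ∈ Finset.range N, q * e / 3 / ((n : ℝ) + 3) ≤ 2 * legEnergy 0 t := by
    intro N
    have h : ∑ n ∈ Finset.range N, (legEnergy n t - legEnergy (n + 2) t) =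
        legEnergy 0 t + legEnergy 1 t - legEnergy N t - legEnergy (N + 1) t := by
      induction N with
      | zero => simp
      | succ N ih => rw [Finset.sum_range_succ, ih]; ring
    have h1 := Finset.sum_le_sum fun n (_ : n ∈ Finset.range N) => hstep n
    have h2 : legEnergy 1 t ≤ legEnergy 0 t := legEnergy_antitone t zero_le_one
    linarith [hnonneg N, hnonneg (N + 1)]
  have hsummable : Summable fun n : ℕ => q * e / 3 / ((n : ℝ) + 3) :=
    summable_of_sum_range_le (fun n => by positivity) hsum
  have h3 : Summable fun n : ℕ => 1 / ((n : ℝ) + 3) := by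
    have := hsummable.mul_left (q * e / 3)⁻¹
    refine this.congr fun n => ?_
    field_simp
  have h4 : Summable fun n : ℕ => 1 / (n : ℝ) := by
    rw [← summable_nat_add_iff 3]
    simpa using h3
  exact Real.not_summable_one_div_natCast h4

theorem tendsto_legQ {t : ℝ} (ht : t ∈ Set.Ioo (0 : ℝ) 1) :
    Tendsto (fun n => legQ n t) atTop (nhds 0) := by
  have hpos : 0 < 4 * (t * (1 - t)) := by
    have := mul_pos ht.1 (sub_pos.mpr ht.2)
    positivity
  rw [← tendsto_add_atTop_iff_nat 1]
  have hsq : Tendsto (fun n => legQ (n + 1) t ^ 2) atTop (nhds 0) := by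
    have h := (tendsto_legEnergy ht).div_const (4 * (t * (1 - t)))
    rw [zero_div] at h
    refine squeeze_zero (fun n => sq_nonneg _) (fun n => ?_) h
    rw [le_div_iff₀ hpos]
    unfold legEnergy
    nlinarith [sq_nonneg (legQ n t - (1 - 2 * t) * legQ (n + 1) t)]
  have h := (Real.continuous_sqrt.tendsto 0).comp hsq
  rw [Real.sqrt_zero] at h
  refine (tendsto_zero_iff_abs_tendsto_zero _).mpr (h.congr fun n => ?_)
  simp [Real.sqrt_sq_eq_abs]

/-! ### The cosecant series -/

theorem mem_integerComplement {x : ℂ} (hx : ∀ m : ℤ, x ≠ m) : x ∈ Complex.integerComplement := by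
  rintro ⟨m, hm⟩
  exact hx m hm.symm

theorem tendsto_csc_series {x : ℂ} (hx : ∀ m : ℤ, x ≠ m) :
    Tendsto (fun N : ℕ => ∑ n ∈ Finset.range N, (-1 : ℂ) ^ (n + 1) * cotTerm x n) atTop
      (nhds (Real.pi / Complex.sin (Real.pi * x) - 1 / x)) := by
  have hx2 : ∀ m : ℤ, x / 2 ≠ m := fun m h => hx (2 * m) (by
    push_cast
    linear_combination 2 * h)
  have hsum : ∀ {y : ℂ}, (∀ m : ℤ, y ≠ m) →
      HasSum (cotTerm y) (Real.pi * Complex.cot (Real.pi * y) - 1 / y) := fun {y} hy => by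
    rw [cot_series_rep' (mem_integerComplement hy)]
    exact (summable_cotTerm (mem_integerComplement hy)).hasSum
  have hall := hsum hx
  have hodd : HasSum (fun k => cotTerm x (2 * k + 1))
      ((Real.pi * Complex.cot (Real.pi * (x / 2)) - 1 / (x / 2)) / 2) := by
    refine ((hsum hx2).div_const 2).congr_fun fun k => ?_
    have h1 : x - (2 * k + 2) ≠ 0 := sub_ne_zero.mpr (by exact_mod_cast hx (2 * k + 2))
    have h2 : x + (2 * k + 2) ≠ 0 := fun h => hx (-(2 * k + 2)) (by
      push_cast
      linear_combination h)
    have h3 : x / 2 - (k + 1) ≠ 0 := fun h => h1 (by linear_combination 2 * h)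
    have h4 : x / 2 + (k + 1) ≠ 0 := fun h => h2 (by linear_combination 2 * h)
    have e1 : x / 2 - (k + 1) = (x - (2 * k + 2)) / 2 := by ring
    have e2 : x / 2 + (k + 1) = (x + (2 * k + 2)) / 2 := by ring
    have e3 : x - (2 * k + 1 + 1) = x - (2 * k + 2) := by ring
    have e4 : x + (2 * k + 1 + 1) = x + (2 * k + 2) := by ring
    simp only [cotTerm]
    push_cast
    rw [e1, e2, e3, e4]
    field_simp
  have heven := (hall.summable.comp_injective
    (fun a b h => by simpa using h : Function.Injective fun k : ℕ => 2 * k)).hasSum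
  have htot := (HasSum.even_add_odd heven hodd).unique hall
  have hfin : HasSum (fun n : ℕ => (-1 : ℂ) ^ (n + 1) * cotTerm x n)
      (-(∑' k, (cotTerm x ∘ fun k : ℕ => 2 * k) k) +
        (Real.pi * Complex.cot (Real.pi * (x / 2)) - 1 / (x / 2)) / 2) := by
    refine HasSum.even_add_odd (heven.neg.congr_fun fun k => ?_) (hodd.congr_fun fun k => ?_)
    · simp [pow_succ, pow_mul]
    · simp [pow_succ, pow_mul]
  convert hfin.tendsto_sum_nat using 2
  have hx0 : x ≠ 0 := by simpa using hx 0
  have hs : Complex.sin (Real.pi * x) ≠ 0 := sin_pi_mul_ne_zero (mem_integerComplement hx)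
  have hs2 : Complex.sin (Real.pi * (x / 2)) ≠ 0 :=
    sin_pi_mul_ne_zero (mem_integerComplement hx2)
  have hd : (Real.pi : ℂ) * x = 2 * (Real.pi * (x / 2)) := by ring
  have hcsc : Real.pi / Complex.sin (Real.pi * x) =
      Real.pi * Complex.cot (Real.pi * (x / 2)) - Real.pi * Complex.cot (Real.pi * x) := by
    have hc2 : Complex.cos (Real.pi * (x / 2)) ≠ 0 := by
      rw [hd, Complex.sin_two_mul] at hs
      exact right_ne_zero_of_mul hs
    simp only [Complex.cot]
    rw [hd, Complex.sin_two_mul, Complex.cos_two_mul]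
    field_simp
    ring
  have e : (1 : ℂ) / (x / 2) = 2 * (1 / x) := by field_simp
  rw [hcsc]
  rw [e] at htot ⊢
  linear_combination htot

theorem sub_natCast_ne_zero {ν : ℂ} (hν : ∀ m : ℤ, ν ≠ m) (n : ℕ) : ν - n ≠ 0 :=
  sub_ne_zero.mpr (by exact_mod_cast hν n)

theorem add_natCast_ne_zero {ν : ℂ} (hν : ∀ m : ℤ, ν ≠ m) (n : ℕ) : ν + n ≠ 0 := fun h =>
  hν (-n) (by
    push_cast
    linear_combination h)

theorem legendre_denominator {ν : ℂ} (n : ℕ) :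
    ν * (ν + 1) - n * (n + 1) = (ν - n) * (ν + (n + 1 : ℕ)) := by
  push_cast
  ring

theorem tendsto_legendre_coeff_sum {ν : ℂ} (hν : ∀ m : ℤ, ν ≠ m) :
    Tendsto (fun N : ℕ => ∑ l ∈ Finset.range (N + 1),
        (-1 : ℂ) ^ l * (2 * l + 1) / (ν * (ν + 1) - l * (l + 1))) atTop
      (nhds (Real.pi / Complex.sin (Real.pi * ν))) := by
  have hform : ∀ N : ℕ, ∑ l ∈ Finset.range (N + 1),
      (-1 : ℂ) ^ l * (2 * l + 1) / (ν * (ν + 1) - l * (l + 1)) =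
      1 / ν + ∑ n ∈ Finset.range N, (-1 : ℂ) ^ (n + 1) * cotTerm ν n -
        (-1) ^ N / (ν + (N + 1 : ℕ)) := by
    intro N
    induction N with
    | zero =>
      have h0 := sub_natCast_ne_zero hν 0
      have h1 := add_natCast_ne_zero hν 1
      simp only [Nat.cast_zero, sub_zero, Nat.cast_one] at h0 h1
      simp
      field_simp
      ring
    | succ N ih =>
      rw [Finset.sum_range_succ, ih, Finset.sum_range_succ _ N, legendre_denominator]
      have h0 := sub_natCast_ne_zero hν (N + 1)
      have h1 := add_natCast_ne_zero hν (N + 1)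
      have h2 := add_natCast_ne_zero hν (N + 1 + 1)
      simp only [cotTerm]
      push_cast at h0 h1 h2 ⊢
      field_simp
      ring
  have htail : Tendsto (fun N : ℕ => (-1 : ℂ) ^ N / (ν + (N + 1 : ℕ))) atTop (nhds 0) := by
    have h1 : Tendsto (fun N : ℕ => ‖ν + (N + 1 : ℕ)‖) atTop atTop := by
      refine tendsto_atTop_mono (f := fun N : ℕ => (N : ℝ) + (1 - ‖ν‖)) (fun N => ?_)
        (tendsto_atTop_add_const_right _ _ tendsto_natCast_atTop_atTop)
      have h := norm_sub_le (ν + (N + 1 : ℕ)) ν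
      rw [add_sub_cancel_left, Complex.norm_natCast] at h
      push_cast at h ⊢
      linarith
    rw [tendsto_zero_iff_norm_tendsto_zero]
    refine h1.inv_tendsto_atTop.congr fun N => ?_
    simp
  have h := ((tendsto_csc_series hν).const_add (1 / ν)).sub htail
  simp only [add_sub_cancel, sub_zero] at h
  exact h.congr fun N => (hform N).symm

/-! ### The Legendre case -/

theorem one_add_natCast_ne_zero (n : ℕ) : (1 : ℂ) + n ≠ 0 := by
  rw [add_comm]
  exact_mod_cast n.succ_ne_zero

theorem norm_ofReal_lt_one {t : ℝ} (ht : t ∈ Set.Ico (0 : ℝ) 1) : ‖(t : ℂ)‖ < 1 := by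
  rw [Complex.norm_real, Real.norm_of_nonneg ht.1]
  exact ht.2

theorem hasDerivAt_legendreF (ν : ℂ) {t : ℝ} (ht : t ∈ Set.Ico (0 : ℝ) 1) :
    HasDerivAt (fun s : ℝ => F21 (-ν) (ν + 1) 1 s)
      (-(ν * (ν + 1)) * F21 (1 - ν) (ν + 2) 2 t) t := by
  refine (hasDerivAt_F21 one_add_natCast_ne_zero (norm_ofReal_lt_one ht)).comp_ofReal.congr_deriv ?_
  rw [show -ν + 1 = 1 - ν by ring, show ν + 1 + 1 = ν + 2 by ring,
    show (1 : ℂ) + 1 = 2 by norm_num]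
  ring

theorem hasDerivAt_mul_legendreF (ν : ℂ) {t : ℝ} (ht : t ∈ Set.Ico (0 : ℝ) 1) :
    HasDerivAt (fun s : ℝ => (s : ℂ) * (1 - s) *
        (-(ν * (ν + 1)) * F21 (1 - ν) (ν + 2) 2 s))
      (-(ν * (ν + 1)) * F21 (-ν) (ν + 1) 1 t) t := by
  have hc2 := add_one_add_natCast_ne_zero one_add_natCast_ne_zero
  have h := hasDerivAt_F21 (a := -ν + 1) (b := ν + 1 + 1) hc2 (norm_ofReal_lt_one ht)
  have hode := F21_ode (a := -ν) (b := ν + 1) one_add_natCast_ne_zero (norm_ofReal_lt_one ht)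
  have hid := (hasDerivAt_id (t : ℂ))
  have hmul := ((hid.mul (hid.const_sub 1)).mul (h.const_mul (-(ν * (ν + 1))))).comp_ofReal
  rw [show (1 : ℂ) + 1 = 2 by norm_num, show -ν + 1 = 1 - ν by ring,
    show ν + 1 + 1 = ν + 2 by ring] at hmul hode
  refine hmul.congr_deriv ?_
  simp only [id, Pi.mul_apply]
  linear_combination hode

theorem legendre_stability {ν : ℂ} {T ε : ℝ} (hT0 : 0 ≤ T) (hT1 : T < 1)
    {u u' r R : ℝ → ℂ} (hu : ∀ t ∈ Set.Icc 0 T, HasDerivAt u (u' t) t)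
    (hv : ∀ t ∈ Set.Icc 0 T,
      HasDerivAt (fun s : ℝ => (s : ℂ) * (1 - s) * u' s - r s) (-(ν * (ν + 1)) * u t) t)
    (hu0 : u 0 = 0) (hr0 : r 0 = 0) (hR : ContinuousOn R (Set.Icc 0 T)) (hR0 : R 0 = 0)
    (hR' : ∀ t ∈ Set.Ioo 0 T, HasDerivAt R (r t / (t * (1 - t))) t)
    (hRb : ∀ t ∈ Set.Icc 0 T, ‖R t‖ ≤ ε) :
    ∀ t ∈ Set.Icc 0 T,
      ‖u t‖ ≤ 2 * ε * Real.exp ((2 * ((1 - T)⁻¹ * ‖ν * (ν + 1)‖) + 1) * T) ∧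
      ‖(t : ℂ) * (1 - t) * u' t - r t‖ ≤
        ‖ν * (ν + 1)‖ * (2 * ε * Real.exp ((2 * ((1 - T)⁻¹ * ‖ν * (ν + 1)‖) + 1) * T)) * T := by
  have hT : 0 < 1 - T := sub_pos.mpr hT1
  refine norm_le_of_singular_system (u := u)
    (v := fun t : ℝ => (t : ℂ) * (1 - t) * u' t - r t)
    (v' := fun t => -(ν * (ν + 1)) * u t)
    (w := fun t : ℝ => ((t : ℂ) * (1 - t) * u' t - r t) / (t * (1 - t)))
    hT0 (by positivity) (norm_nonneg _)
    (fun t ht => (hu t ht).continuousAt.continuousWithinAt)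
    (fun t ht => (hv t ht).continuousAt.continuousWithinAt) hR hu0 (by simp [hr0]) hR0
    (fun t ht => hv t ⟨ht.1.le, ht.2.le⟩) (fun t _ => by simp) (fun t ht => ?_) (fun t ht => ?_) hRb
  · refine ((hu t ⟨ht.1.le, ht.2.le⟩).sub (hR' t ht)).congr_deriv ?_
    have h1 : (t : ℂ) ≠ 0 := by exact_mod_cast ht.1.ne'
    have h2 : (1 : ℂ) - t ≠ 0 := by exact_mod_cast (sub_pos.mpr (ht.2.trans hT1)).ne'
    field_simp
  · have h1 : 0 < 1 - t := sub_pos.mpr (ht.2.trans hT1)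
    have h2 : ‖(t : ℂ) * (1 - t)‖ = t * (1 - t) := by
      rw [← Complex.ofReal_one, ← Complex.ofReal_sub, ← Complex.ofReal_mul, Complex.norm_real,
        Real.norm_of_nonneg (mul_pos ht.1 h1).le]
    have h3 : (1 - t)⁻¹ ≤ (1 - T)⁻¹ := inv_anti₀ hT (by linarith [ht.2])
    rw [norm_div, h2]
    have h4 := ht.1.ne'
    calc _ = (1 - t)⁻¹ * ‖(t : ℂ) * (1 - t) * u' t - r t‖ := by field_simp
      _ ≤ _ := mul_le_mul_of_nonneg_right h3 (norm_nonneg _)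

theorem legQ_eq_F21 (n : ℕ) {t : ℝ} (ht : t ∈ Set.Ioo (0 : ℝ) 1) :
    (legQ n t : ℂ) = F21 (-n) (n + 1) 1 t ∧
      (dlegQ n t : ℂ) = -((n : ℂ) * (n + 1)) * F21 (1 - n) (n + 2) 2 t := by
  have h := legendre_stability (ν := n) (T := t) (ε := 0) ht.1.le ht.2
    (u := fun s => (legQ n s : ℂ) - F21 (-n) (n + 1) 1 s)
    (u' := fun s => (dlegQ n s : ℂ) - -((n : ℂ) * (n + 1)) * F21 (1 - n) (n + 2) 2 s)
    (r := fun _ => 0) (R := fun _ => 0)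
    (fun s hs => (hasDerivAt_legQ n s).ofReal_comp.sub
      (hasDerivAt_legendreF n ⟨hs.1, hs.2.trans_lt ht.2⟩))
    (fun s hs => by
      have h1 := (hasDerivAt_mul_dlegQ n s).ofReal_comp.sub
        (hasDerivAt_mul_legendreF n ⟨hs.1, hs.2.trans_lt ht.2⟩)
      refine (h1.congr_deriv ?_).congr_of_eventuallyEq (Eventually.of_forall fun x => ?_)
      · push_cast
        ring
      · simp only [Pi.sub_apply]
        push_cast
        ring)
    (by simp [legQ_zero_right, F21_zero]) rfl continuousOn_const rfl
    (fun s _ => by simpa using hasDerivAt_const s (0 : ℂ)) (by simp) t ⟨ht.1.le, le_rfl⟩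
  obtain ⟨h1, h2⟩ := h
  simp only [mul_zero, zero_mul, norm_le_zero_iff, sub_zero] at h1 h2
  have h3 : (t : ℂ) ≠ 0 := by exact_mod_cast ht.1.ne'
  have h4 : (1 : ℂ) - t ≠ 0 := by exact_mod_cast (sub_pos.mpr ht.2).ne'
  refine ⟨sub_eq_zero.mp h1, sub_eq_zero.mp ?_⟩
  simpa [h3, h4] using h2

/-- The integrated forcing term of the Legendre equation for the partial sums. -/
noncomputable def legR (n : ℕ) (t : ℝ) : ℝ := (-1) ^ n * (legQ n t - legQ (n + 1) t) / 2

theorem hasDerivAt_legR (n : ℕ) (t : ℝ) :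
    HasDerivAt (legR n) (∑ l ∈ Finset.range (n + 1), (-1) ^ l * (2 * l + 1) * legQ l t) t := by
  rw [sum_legQ]
  exact (((hasDerivAt_legQ n t).sub (hasDerivAt_legQ (n + 1) t)).const_mul _).div_const 2

theorem legR_zero_right (n : ℕ) : legR n 0 = 0 := by simp [legR, legQ_zero_right]

theorem abs_legR_le {t : ℝ} (ht : t ∈ Set.Ioo (0 : ℝ) 1) (n : ℕ) : |legR n t| ≤ 2 * √t := by
  rw [legR, abs_div, abs_mul, abs_pow, abs_neg, abs_one, one_pow, one_mul, abs_two]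
  linarith [abs_legQ_sub_le ht n]

theorem tendsto_legR {t : ℝ} (ht : t ∈ Set.Ioo (0 : ℝ) 1) :
    Tendsto (fun n => legR n t) atTop (nhds 0) := by
  have h := (((tendsto_legQ ht).sub ((tendsto_add_atTop_iff_nat 1).mpr (tendsto_legQ ht))).abs)
  simp only [sub_zero, abs_zero] at h
  refine squeeze_zero_norm (fun n => ?_) h
  rw [Real.norm_eq_abs, legR, abs_div, abs_mul, abs_pow, abs_neg, abs_one, one_pow, one_mul,
    abs_two]
  linarith [abs_nonneg (legQ n t - legQ (n + 1) t)]

theorem legR_quotient_bound {T t : ℝ} (hT : T < 1) (ht : t ∈ Set.Ioc 0 T) (n : ℕ) :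
    ‖legR n t / (t * (1 - t))‖ ≤ 2 * (1 - T)⁻¹ * t ^ (-(1 / 2) : ℝ) := by
  have ht1 : t ∈ Set.Ioo (0 : ℝ) 1 := ⟨ht.1, ht.2.trans_lt hT⟩
  have h1 : 0 < 1 - t := sub_pos.mpr ht1.2
  have hT' : 0 < 1 - T := sub_pos.mpr hT
  have hs : √t ^ 2 = t := Real.sq_sqrt ht.1.le
  have hs0 : 0 < √t := Real.sqrt_pos.mpr ht.1
  rw [Real.norm_eq_abs, abs_div, abs_of_pos (mul_pos ht.1 h1), Real.rpow_neg ht.1.le,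
    ← Real.sqrt_eq_rpow, div_le_iff₀ (mul_pos ht.1 h1)]
  refine (abs_legR_le ht1 n).trans ?_
  have e : 2 * (1 - T)⁻¹ * (√t)⁻¹ * (t * (1 - t)) = 2 * √t * ((1 - T)⁻¹ * (1 - t)) := by
    nth_rewrite 2 [← hs]
    field_simp
  rw [e]
  refine le_mul_of_one_le_right (by positivity) ?_
  rw [inv_mul_eq_div, one_le_div hT']
  linarith [ht.2]

theorem intervalIntegrable_bound {T : ℝ} (c : ℝ) :
    IntervalIntegrable (fun t : ℝ => c * t ^ (-(1 / 2) : ℝ)) MeasureTheory.volume 0 T :=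
  (intervalIntegral.intervalIntegrable_rpow' (by norm_num)).const_mul c

theorem continuous_legR (n : ℕ) : Continuous (legR n) :=
  continuous_iff_continuousAt.mpr fun t => (hasDerivAt_legR n t).continuousAt

theorem measurable_legR_quotient (n : ℕ) : Measurable fun t : ℝ => legR n t / (t * (1 - t)) :=
  (continuous_legR n).measurable.div (by fun_prop)

theorem intervalIntegrable_legR {T : ℝ} (hT0 : 0 ≤ T) (hT : T < 1) (n : ℕ) :
    IntervalIntegrable (fun t : ℝ => legR n t / (t * (1 - t))) MeasureTheory.volume 0 T := by
  refine (intervalIntegrable_bound (2 * (1 - T)⁻¹)).mono_fun'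
    (measurable_legR_quotient n).aestronglyMeasurable ?_
  refine (MeasureTheory.ae_restrict_iff' measurableSet_uIoc).mpr (Eventually.of_forall ?_)
  intro t ht
  rw [Set.uIoc_of_le hT0] at ht
  exact legR_quotient_bound hT ht n

theorem tendsto_integral_legR {T : ℝ} (hT0 : 0 ≤ T) (hT : T < 1) :
    Tendsto (fun n => ∫ t in (0 : ℝ)..T, ‖legR n t / (t * (1 - t))‖) atTop (nhds 0) := by
  have h := intervalIntegral.tendsto_integral_filter_of_dominated_convergence
    (μ := MeasureTheory.volume) (a := 0) (b := T) (l := atTop)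
    (F := fun n t => ‖legR n t / (t * (1 - t))‖) (f := fun _ => (0 : ℝ))
    (fun t : ℝ => 2 * (1 - T)⁻¹ * t ^ (-(1 / 2) : ℝ))
    (Eventually.of_forall fun n => (measurable_legR_quotient n).norm.aestronglyMeasurable)
    (Eventually.of_forall fun n => Eventually.of_forall fun t ht => by
      rw [Set.uIoc_of_le hT0] at ht
      rw [norm_norm]
      exact legR_quotient_bound hT ht n)
    (intervalIntegrable_bound _)
    (Eventually.of_forall fun t ht => by
      rw [Set.uIoc_of_le hT0] at ht
      simpa using ((tendsto_legR ⟨ht.1, ht.2.trans_lt hT⟩).div_const (t * (1 - t))).norm)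
  simpa using h

/-- Partial sums of the Legendre series. -/
noncomputable def legS (ν : ℂ) (N : ℕ) (t : ℝ) : ℂ :=
  ∑ l ∈ Finset.range (N + 1), (-1 : ℂ) ^ l * (2 * l + 1) / (ν * (ν + 1) - l * (l + 1)) * legQ l t

/-- Derivatives of the partial sums of the Legendre series. -/
noncomputable def dlegS (ν : ℂ) (N : ℕ) (t : ℝ) : ℂ :=
  ∑ l ∈ Finset.range (N + 1), (-1 : ℂ) ^ l * (2 * l + 1) / (ν * (ν + 1) - l * (l + 1)) * dlegQ l t

theorem hasDerivAt_legS (ν : ℂ) (N : ℕ) (t : ℝ) : HasDerivAt (legS ν N) (dlegS ν N t) t :=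
  HasDerivAt.fun_sum fun l _ => (hasDerivAt_legQ l t).ofReal_comp.const_mul _

theorem hasDerivAt_mul_dlegS {ν : ℂ} (hν : ∀ m : ℤ, ν ≠ m) (N : ℕ) (t : ℝ) :
    HasDerivAt (fun s : ℝ => (s : ℂ) * (1 - s) * dlegS ν N s - legR N s)
      (-(ν * (ν + 1)) * legS ν N t) t := by
  have h := (HasDerivAt.fun_sum (u := Finset.range (N + 1)) fun l _ =>
    (hasDerivAt_mul_dlegQ l t).ofReal_comp.const_mul
      ((-1 : ℂ) ^ l * (2 * l + 1) / (ν * (ν + 1) - l * (l + 1)))).sub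
    (hasDerivAt_legR N t).ofReal_comp
  refine (h.congr_deriv ?_).congr_of_eventuallyEq (Eventually.of_forall fun x => ?_)
  · push_cast
    rw [legS, Finset.mul_sum, ← Finset.sum_sub_distrib]
    refine Finset.sum_congr rfl fun l _ => ?_
    have h1 : ν * (ν + 1) - l * (l + 1) ≠ 0 := by
      rw [legendre_denominator]
      exact mul_ne_zero (sub_natCast_ne_zero hν l) (add_natCast_ne_zero hν (l + 1))
    field_simp
    ring
  · simp only [Pi.sub_apply, dlegS, Finset.mul_sum]
    congr 1
    refine Finset.sum_congr rfl fun l _ => ?_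
    push_cast
    ring

theorem tendsto_legS {ν : ℂ} (hν : ∀ m : ℤ, ν ≠ m) {t : ℝ} (ht : t ∈ Set.Ioo (0 : ℝ) 1) :
    Tendsto (fun N => legS ν N t) atTop
      (nhds (Real.pi / Complex.sin (Real.pi * ν) * F21 (-ν) (ν + 1) 1 t)) ∧
    Tendsto (fun N => dlegS ν N t) atTop
      (nhds (Real.pi / Complex.sin (Real.pi * ν) *
        (-(ν * (ν + 1)) * F21 (1 - ν) (ν + 2) 2 t))) := by
  obtain ⟨ht0, ht1⟩ := ht
  set c : ℕ → ℂ := fun N => legS ν N 0 with hc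
  have hclim : Tendsto c atTop (nhds (Real.pi / Complex.sin (Real.pi * ν))) := by
    refine (tendsto_legendre_coeff_sum hν).congr fun N => ?_
    simp [hc, legS, legQ_zero_right]
  set ε : ℕ → ℝ := fun N => ∫ s in (0 : ℝ)..t, ‖legR N s / (s * (1 - s))‖ with hε
  have hεlim : Tendsto ε atTop (nhds 0) := tendsto_integral_legR ht0.le ht1
  have hint := fun N => intervalIntegrable_legR ht0.le ht1 N
  have hstab := fun N => legendre_stability (ν := ν) (T := t) (ε := ε N) ht0.le ht1
    (u := fun s => legS ν N s - c N * F21 (-ν) (ν + 1) 1 s)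
    (u' := fun s => dlegS ν N s - c N * (-(ν * (ν + 1)) * F21 (1 - ν) (ν + 2) 2 s))
    (r := fun s => legR N s)
    (R := fun x => ((∫ s in (0 : ℝ)..x, legR N s / (s * (1 - s)) : ℝ) : ℂ))
    (fun s hs => (hasDerivAt_legS ν N s).sub
      ((hasDerivAt_legendreF ν ⟨hs.1, hs.2.trans_lt ht1⟩).const_mul _))
    (fun s hs => by
      have h1 := (hasDerivAt_mul_dlegS hν N s).sub
        ((hasDerivAt_mul_legendreF ν ⟨hs.1, hs.2.trans_lt ht1⟩).const_mul (c N))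
      refine (h1.congr_deriv ?_).congr_of_eventuallyEq (Eventually.of_forall fun x => ?_)
      · ring
      · simp only [Pi.sub_apply]
        ring)
    (by simp [hc, F21_zero]) (by simp [legR_zero_right])
    (Complex.continuous_ofReal.comp_continuousOn <| by
      have h := intervalIntegral.continuousOn_primitive_interval
        ((intervalIntegrable_iff_integrableOn_Icc_of_le ht0.le).mp (hint N) |>.mono_set
          (Set.uIcc_of_le ht0.le).le)
      rwa [Set.uIcc_of_le ht0.le] at h)
    (by simp)
    (fun s hs => by
      have h1 : IntervalIntegrable (fun s : ℝ => legR N s / (s * (1 - s)))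
          MeasureTheory.volume 0 s := intervalIntegrable_legR hs.1.le (hs.2.trans ht1) N
      have h2 : ContinuousAt (fun s : ℝ => legR N s / (s * (1 - s))) s :=
        (continuous_legR N).continuousAt.div (by fun_prop)
          (mul_pos hs.1 (sub_pos.mpr (hs.2.trans ht1))).ne'
      have h3 := (intervalIntegral.integral_hasDerivAt_right h1
        (measurable_legR_quotient N).stronglyMeasurable.stronglyMeasurableAtFilter h2).ofReal_comp
      refine h3.congr_deriv ?_
      push_cast
      rfl)
    (fun s hs => by
      rw [Complex.norm_real]
      refine (intervalIntegral.norm_integral_le_integral_norm hs.1).trans ?_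
      exact intervalIntegral.integral_mono_interval le_rfl hs.1 hs.2
        (Eventually.of_forall fun _ => norm_nonneg _) (hint N).norm)
    t ⟨ht0.le, le_rfl⟩
  constructor
  · have h1 : Tendsto (fun N => legS ν N t - c N * F21 (-ν) (ν + 1) 1 t) atTop (nhds 0) := by
      refine squeeze_zero_norm (fun N => (hstab N).1) ?_
      simpa using (hεlim.const_mul 2).mul_const _
    have h2 := h1.add (hclim.mul_const (F21 (-ν) (ν + 1) 1 t))
    simpa using h2
  · have h1 : Tendsto (fun N => (t : ℂ) * (1 - t) *
        (dlegS ν N t - c N * (-(ν * (ν + 1)) * F21 (1 - ν) (ν + 2) 2 t)) - legR N t)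
        atTop (nhds 0) := by
      refine squeeze_zero_norm (fun N => (hstab N).2) ?_
      simpa using (((hεlim.const_mul 2).mul_const _).const_mul _).mul_const t
    have h2 := (Complex.continuous_ofReal.tendsto 0).comp (tendsto_legR ⟨ht0, ht1⟩)
    rw [Complex.ofReal_zero] at h2
    have h3 : (t : ℂ) ≠ 0 := by exact_mod_cast ht0.ne'
    have h4 : (1 : ℂ) - t ≠ 0 := by exact_mod_cast (sub_pos.mpr ht1).ne'
    have h5 := (((h1.add h2).div_const ((t : ℂ) * (1 - t))).add
      (hclim.mul_const (-(ν * (ν + 1)) * F21 (1 - ν) (ν + 2) 2 t)))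
    simp only [add_zero, zero_div, zero_add] at h5
    refine h5.congr fun N => ?_
    simp only [Function.comp_apply]
    field_simp
    ring

/-! ### The Chebyshev case -/

theorem harmonic_stability {a : ℂ} {T ε : ℝ} (hT : 0 ≤ T) {u u' r R : ℝ → ℂ}
    (hu : ∀ t ∈ Set.Icc 0 T, HasDerivAt u (u' t) t)
    (hv : ∀ t ∈ Set.Icc 0 T, HasDerivAt (fun s => u' s - r s) (-a ^ 2 * u t) t)
    (hu0 : u 0 = 0) (hv0 : u' 0 - r 0 = 0) (hR : ∀ t ∈ Set.Icc 0 T, HasDerivAt R (r t) t)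
    (hR0 : R 0 = 0) (hRb : ∀ t ∈ Set.Icc 0 T, ‖R t‖ ≤ ε) :
    ∀ t ∈ Set.Icc 0 T, ‖u t‖ ≤ 2 * ε * Real.exp ((2 * (T * ‖a ^ 2‖) + 1) * T) ∧
      ‖u' t - r t‖ ≤ ‖a ^ 2‖ * (2 * ε * Real.exp ((2 * (T * ‖a ^ 2‖) + 1) * T)) * T :=
  norm_le_of_singular_system (v := fun t => u' t - r t) (v' := fun t => -a ^ 2 * u t)
    (w := fun t => u' t - r t) hT hT (norm_nonneg _)
    (fun t ht => (hu t ht).continuousAt.continuousWithinAt)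
    (fun t ht => (hv t ht).continuousAt.continuousWithinAt)
    (fun t ht => (hR t ht).continuousAt.continuousWithinAt) hu0 hv0 hR0
    (fun t ht => hv t ⟨ht.1.le, ht.2.le⟩) (fun t _ => by simp)
    (fun t ht => (hu t ⟨ht.1.le, ht.2.le⟩).sub (hR t ⟨ht.1.le, ht.2.le⟩))
    (fun t ht => by
      rw [mul_comm]
      exact mul_le_mul_of_nonneg_right ht.2.le (norm_nonneg _)) hRb

theorem three_half_add_natCast_ne_zero (n : ℕ) : (3 / 2 : ℂ) + n ≠ 0 := by
  have h : ((3 + 2 * n : ℕ) : ℂ) ≠ 0 := Nat.cast_ne_zero.mpr (by omega)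
  intro h'
  refine h ?_
  push_cast
  linear_combination 2 * h'

theorem half_one_sub_cos_mem {φ : ℝ} (h0 : 0 ≤ φ) (hpi : φ < Real.pi) :
    (1 - Real.cos φ) / 2 ∈ Set.Ico (0 : ℝ) 1 := by
  have h1 := Real.cos_le_one φ
  have h2 : -1 < Real.cos φ := by
    have := Real.cos_lt_cos_of_nonneg_of_le_pi h0 le_rfl hpi
    simpa using this
  constructor <;> linarith

theorem hasDerivAt_csin_mul (a : ℂ) (t : ℝ) :
    HasDerivAt (fun s : ℝ => Complex.sin (a * s)) (a * Complex.cos (a * t)) t := by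
  have h := (Complex.hasDerivAt_sin (a * t)).comp (t : ℂ) ((hasDerivAt_id (t : ℂ)).const_mul a)
  exact h.comp_ofReal.congr_deriv (by ring)

theorem hasDerivAt_ccos_mul (a : ℂ) (t : ℝ) :
    HasDerivAt (fun s : ℝ => Complex.cos (a * s)) (-(a * Complex.sin (a * t))) t := by
  have h := (Complex.hasDerivAt_cos (a * t)).comp (t : ℂ) ((hasDerivAt_id (t : ℂ)).const_mul a)
  exact h.comp_ofReal.congr_deriv (by ring)

theorem hasDerivAt_F21_half_one_sub_cos {a b : ℂ} {c : ℂ} (hc : ∀ n : ℕ, c + n ≠ 0) {φ : ℝ}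
    (h0 : 0 ≤ φ) (hpi : φ < Real.pi) :
    HasDerivAt (fun s : ℝ => F21 a b c ((1 - Complex.cos s) / 2))
      (a * b / c * F21 (a + 1) (b + 1) (c + 1) ((1 - Complex.cos φ) / 2) *
        (Complex.sin φ / 2)) φ := by
  have hn : ‖(1 - Complex.cos φ) / 2‖ < 1 := by
    have := norm_ofReal_lt_one (half_one_sub_cos_mem h0 hpi)
    push_cast at this
    exact this
  have h := (hasDerivAt_F21 (a := a) (b := b) hc hn).comp (φ : ℂ)
    (((Complex.hasDerivAt_cos (φ : ℂ)).const_sub 1).div_const 2)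
  exact h.comp_ofReal.congr_deriv (by ring)

theorem F21_three_half_mul_sin (ν : ℂ) {φ : ℝ} (h0 : 0 ≤ φ) (hpi : φ < Real.pi) :
    (ν + 1) * (F21 (-ν) (ν + 2) (3 / 2) ((1 - Complex.cos φ) / 2) * Complex.sin φ) =
      Complex.sin ((ν + 1) * φ) := by
  set F := fun s : ℝ => F21 (-ν) (ν + 2) (3 / 2) ((1 - Complex.cos s) / 2) with hF
  set F₁ := fun s : ℝ => -ν * (ν + 2) / (3 / 2) *
    F21 (-ν + 1) (ν + 2 + 1) (3 / 2 + 1) ((1 - Complex.cos s) / 2) with hF₁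
  have hsin : ∀ t : ℝ, HasDerivAt (fun s : ℝ => Complex.sin s) (Complex.cos t) t := fun t =>
    (Complex.hasDerivAt_sin t).comp_ofReal
  have hcos : ∀ t : ℝ, HasDerivAt (fun s : ℝ => Complex.cos s) (-Complex.sin t) t := fun t =>
    (Complex.hasDerivAt_cos t).comp_ofReal
  have hF' : ∀ t ∈ Set.Icc 0 φ, HasDerivAt F (F₁ t * (Complex.sin t / 2)) t := fun t ht =>
    hasDerivAt_F21_half_one_sub_cos three_half_add_natCast_ne_zero ht.1 (ht.2.trans_lt hpi)
  have h := harmonic_stability (a := ν + 1) (ε := 0) h0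
    (u := fun s => (ν + 1) * (F s * Complex.sin s) - Complex.sin ((ν + 1) * s))
    (u' := fun s => (ν + 1) * (F₁ s * Complex.sin s ^ 2 / 2 + F s * Complex.cos s) -
      (ν + 1) * Complex.cos ((ν + 1) * s))
    (r := fun _ => 0) (R := fun _ => 0)
    (fun t ht => by
      refine ((((hF' t ht).mul (hsin t)).const_mul (ν + 1)).sub
        (hasDerivAt_csin_mul (ν + 1) t)).congr_deriv ?_
      ring)
    (fun t ht => by
      have hn : ‖(1 - Complex.cos t) / 2‖ < 1 := by
        have := norm_ofReal_lt_one (half_one_sub_cos_mem ht.1 (ht.2.trans_lt hpi))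
        push_cast at this
        exact this
      have hode := F21_ode (a := -ν) (b := ν + 2) three_half_add_natCast_ne_zero hn
      have hF₁' := (hasDerivAt_F21_half_one_sub_cos (a := -ν + 1) (b := ν + 2 + 1)
        (add_one_add_natCast_ne_zero three_half_add_natCast_ne_zero) ht.1
        (ht.2.trans_lt hpi)).const_mul (-ν * (ν + 2) / (3 / 2))
      have hd := ((((hF₁'.mul ((hsin t).pow 2)).div_const 2).add
        ((hF' t ht).mul (hcos t))).const_mul (ν + 1)).sub
        ((hasDerivAt_ccos_mul (ν + 1) t).const_mul (ν + 1))
      refine (hd.congr_deriv ?_).congr_of_eventuallyEq (Eventually.of_forall fun x => ?_)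
      · have hsc := Complex.sin_sq_add_cos_sq t
        simp only [hF, hF₁, Pi.pow_apply]
        set G₂ := F21 (-ν + 1 + 1) (ν + 2 + 1 + 1) (3 / 2 + 1 + 1) ((1 - Complex.cos t) / 2)
        set k₂ := (-ν + 1) * (ν + 2 + 1) / (3 / 2 + 1 : ℂ)
        push_cast
        linear_combination (ν + 1) * Complex.sin t * hode +
          (ν + 1) * (-ν * (ν + 2) / (3 / 2)) * k₂ * G₂ * Complex.sin t / 4 * hsc
      · simp [hF₁])
    (by simp) (by simp [hF, F21_zero]) (fun t _ => by simpa using hasDerivAt_const t (0 : ℂ)) rfl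
    (by simp) φ ⟨h0, le_rfl⟩
  have h1 := h.1
  simp only [mul_zero, zero_mul, norm_le_zero_iff] at h1
  exact sub_eq_zero.mp h1

/-- Remainder of the Fourier series of the sawtooth `φ`. -/
noncomputable def sawtooth (N : ℕ) (φ : ℝ) : ℝ :=
  φ + ∑ n ∈ Finset.range N, 2 * (-1) ^ (n + 1) / (n + 1) * Real.sin ((n + 1) * φ)

/-- Primitive of `sawtooth` vanishing at the origin. -/
noncomputable def sawtoothPrim (N : ℕ) (φ : ℝ) : ℝ :=
  φ ^ 2 / 2 + ∑ n ∈ Finset.range N,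
    2 * (-1) ^ (n + 1) / (n + 1) ^ 2 * (1 - Real.cos ((n + 1) * φ))

/-- Derivative of `sawtooth`. -/
noncomputable def altDirichlet (N : ℕ) (φ : ℝ) : ℝ :=
  1 + ∑ n ∈ Finset.range N, 2 * (-1) ^ (n + 1) * Real.cos ((n + 1) * φ)

theorem hasDerivAt_sawtooth (N : ℕ) (φ : ℝ) :
    HasDerivAt (sawtooth N) (altDirichlet N φ) φ := by
  refine (hasDerivAt_id φ).add (HasDerivAt.fun_sum fun n _ => ?_)
  have h : HasDerivAt (fun s : ℝ => Real.sin (((n : ℝ) + 1) * s))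
      (Real.cos ((n + 1) * φ) * (((n : ℝ) + 1) * 1)) φ :=
    ((hasDerivAt_id φ).const_mul ((n : ℝ) + 1)).sin
  refine (h.const_mul (2 * (-1) ^ (n + 1) / (n + 1 : ℝ))).congr_deriv ?_
  have : (n : ℝ) + 1 ≠ 0 := by positivity
  field_simp

theorem hasDerivAt_sawtoothPrim (N : ℕ) (φ : ℝ) :
    HasDerivAt (sawtoothPrim N) (sawtooth N φ) φ := by
  refine HasDerivAt.add (((hasDerivAt_pow 2 φ).div_const 2).congr_deriv (by simp))
    (HasDerivAt.fun_sum fun n _ => ?_)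
  have h : HasDerivAt (fun s : ℝ => Real.cos (((n : ℝ) + 1) * s))
      (-Real.sin ((n + 1) * φ) * (((n : ℝ) + 1) * 1)) φ :=
    ((hasDerivAt_id φ).const_mul ((n : ℝ) + 1)).cos
  refine ((h.const_sub 1).const_mul (2 * (-1) ^ (n + 1) / (n + 1 : ℝ) ^ 2)).congr_deriv ?_
  have : (n : ℝ) + 1 ≠ 0 := by positivity
  field_simp

theorem altDirichlet_mul_cos (N : ℕ) (φ : ℝ) :
    altDirichlet N φ * Real.cos (φ / 2) = (-1) ^ N * Real.cos ((N + 1 / 2) * φ) := by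
  induction N with
  | zero => simp [altDirichlet, div_eq_inv_mul]
  | succ N ih =>
    have h1 : altDirichlet (N + 1) φ =
        altDirichlet N φ + 2 * (-1) ^ (N + 1) * Real.cos ((N + 1) * φ) := by
      simp [altDirichlet, Finset.sum_range_succ, add_assoc]
    have h2 : ((N : ℝ) + 1 / 2) * φ = (N + 1) * φ - φ / 2 := by ring
    have h3 : (((N + 1 : ℕ) : ℝ) + 1 / 2) * φ = (N + 1) * φ + φ / 2 := by
      push_cast
      ring
    rw [h1, add_mul, ih, h2, h3, Real.cos_add, Real.cos_sub]
    ring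

theorem abs_sawtooth_le {T t : ℝ} (hT : T < Real.pi) (ht : t ∈ Set.Icc 0 T) (N : ℕ) :
    |sawtooth N t| ≤ ((N : ℝ) + 1 / 2)⁻¹ *
      ((Real.cos (T / 2))⁻¹ + T * ((Real.cos (T / 2))⁻¹) ^ 2) := by
  have hT0 : 0 ≤ T := ht.1.trans ht.2
  set κ := Real.cos (T / 2) with hκ
  set m : ℝ := (N : ℝ) + 1 / 2 with hm
  have hm0 : 0 < m := by positivity
  have hκ0 : 0 < κ := Real.cos_pos_of_mem_Ioo ⟨by linarith [Real.pi_pos], by linarith⟩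
  have hcos : ∀ x ∈ Set.Icc 0 T, κ ≤ Real.cos (x / 2) := fun x hx =>
    Real.cos_le_cos_of_nonneg_of_le_pi (by linarith [hx.1]) (by linarith) (by linarith [hx.2])
  have hinv : ∀ x ∈ Set.Icc 0 T, (Real.cos (x / 2))⁻¹ ≤ κ⁻¹ := fun x hx =>
    inv_anti₀ hκ0 (hcos x hx)
  have hinv0 : ∀ x ∈ Set.Icc 0 T, 0 ≤ (Real.cos (x / 2))⁻¹ := fun x hx =>
    inv_nonneg.mpr (hκ0.trans_le (hcos x hx)).le
  have hmain := Convex.norm_image_sub_le_of_norm_hasDerivWithin_le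
    (f := fun x => sawtooth N x - (-1) ^ N * (m⁻¹ * (Real.sin (m * x) * (Real.cos (x / 2))⁻¹)))
    (f' := fun x => -((-1) ^ N * (m⁻¹ * (Real.sin (m * x) * Real.sin (x / 2) / 2 *
      ((Real.cos (x / 2))⁻¹) ^ 2)))) (C := m⁻¹ * (κ⁻¹) ^ 2) (s := Set.Icc 0 T) (x := 0) (y := t)
    (fun x hx => by
      have hc : Real.cos (x / 2) ≠ 0 := (hκ0.trans_le (hcos x hx)).ne'
      have h1 : HasDerivAt (fun s : ℝ => Real.sin (m * s)) (Real.cos (m * x) * (m * 1)) x :=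
        ((hasDerivAt_id x).const_mul m).sin
      have h2 : HasDerivAt (fun s : ℝ => Real.cos (s / 2)) (-Real.sin (x / 2) * (1 / 2)) x :=
        ((hasDerivAt_id x).div_const 2).cos
      refine ((hasDerivAt_sawtooth N x).sub
        (((h1.mul (h2.inv hc)).const_mul m⁻¹).const_mul ((-1) ^ N))).hasDerivWithinAt.congr_deriv ?_
      have h3 : altDirichlet N x = (-1) ^ N * Real.cos (m * x) * (Real.cos (x / 2))⁻¹ := by
        rw [← altDirichlet_mul_cos, mul_inv_cancel_right₀ hc]
      rw [h3, Pi.inv_apply]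
      field_simp
      ring)
    (fun x hx => by
      simp only [norm_neg, norm_mul, norm_pow, norm_div, norm_inv, norm_one, one_pow, one_mul,
        Real.norm_eq_abs, abs_of_pos hm0, abs_two]
      rw [← abs_inv, abs_of_nonneg (hinv0 x hx)]
      have h1 := Real.abs_sin_le_one (m * x)
      have h2 := Real.abs_sin_le_one (x / 2)
      have h3 : |Real.sin (m * x)| * |Real.sin (x / 2)| ≤ 1 :=
        mul_le_one₀ h1 (abs_nonneg _) h2
      have h4 : ((Real.cos (x / 2))⁻¹) ^ 2 ≤ (κ⁻¹) ^ 2 :=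
        pow_le_pow_left₀ (hinv0 x hx) (hinv x hx) 2
      refine mul_le_mul_of_nonneg_left ?_ (inv_pos.mpr hm0).le
      calc _ ≤ 1 * ((Real.cos (x / 2))⁻¹) ^ 2 := by gcongr; linarith
        _ ≤ _ := by rwa [one_mul])
    (convex_Icc 0 T) ⟨le_rfl, hT0⟩ ht
  have h0 : sawtooth N 0 = 0 := by simp [sawtooth]
  have hb : |(-1) ^ N * (m⁻¹ * (Real.sin (m * t) * (Real.cos (t / 2))⁻¹))| ≤ m⁻¹ * κ⁻¹ := by
    rw [abs_mul, abs_mul, abs_mul, abs_pow, abs_neg, abs_one, one_pow, one_mul,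
      abs_of_pos (inv_pos.mpr hm0), abs_of_nonneg (hinv0 t ht)]
    refine mul_le_mul_of_nonneg_left ?_ (inv_pos.mpr hm0).le
    calc _ ≤ 1 * (Real.cos (t / 2))⁻¹ :=
          mul_le_mul_of_nonneg_right (Real.abs_sin_le_one _) (hinv0 t ht)
      _ ≤ _ := by rw [one_mul]; exact hinv t ht
  simp only [h0, mul_zero, Real.sin_zero, zero_mul, sub_zero, Real.norm_eq_abs,
    abs_of_nonneg ht.1] at hmain
  have hk : 0 ≤ m⁻¹ * (κ⁻¹) ^ 2 := by positivity
  have h5 : m⁻¹ * (κ⁻¹) ^ 2 * t ≤ m⁻¹ * (κ⁻¹) ^ 2 * T := mul_le_mul_of_nonneg_left ht.2 hk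
  have h6 := abs_sub_abs_le_abs_sub (sawtooth N t)
    ((-1) ^ N * (m⁻¹ * (Real.sin (m * t) * (Real.cos (t / 2))⁻¹)))
  linarith

theorem abs_sawtoothPrim_le {T t B : ℝ} (ht : t ∈ Set.Icc 0 T) {N : ℕ}
    (hB : ∀ x ∈ Set.Icc 0 T, |sawtooth N x| ≤ B) : |sawtoothPrim N t| ≤ B * T := by
  have hT0 : 0 ≤ T := ht.1.trans ht.2
  have h := Convex.norm_image_sub_le_of_norm_hasDerivWithin_le
    (fun x _ => (hasDerivAt_sawtoothPrim N x).hasDerivWithinAt) hB (convex_Icc 0 T)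
    ⟨le_rfl, hT0⟩ ht
  have h0 : sawtoothPrim N 0 = 0 := by simp [sawtoothPrim]
  simp only [h0, sub_zero, Real.norm_eq_abs, abs_of_nonneg ht.1] at h
  exact h.trans (mul_le_mul_of_nonneg_left ht.2 ((abs_nonneg _).trans (hB t ht)))

/-- Partial sums of the Fourier series of `cos (a φ)`, up to a constant factor. -/
noncomputable def cosSeries (a : ℂ) (N : ℕ) (φ : ℝ) : ℂ :=
  1 / a ^ 2 + ∑ n ∈ Finset.range N,
    2 * (-1) ^ (n + 1) / (a ^ 2 - (n + 1) ^ 2) * Complex.cos ((n + 1) * φ)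

/-- Derivatives of `cosSeries`. -/
noncomputable def dcosSeries (a : ℂ) (N : ℕ) (φ : ℝ) : ℂ :=
  ∑ n ∈ Finset.range N,
    2 * (-1) ^ n * (n + 1) / (a ^ 2 - (n + 1) ^ 2) * Complex.sin ((n + 1) * φ)

theorem hasDerivAt_cosSeries (a : ℂ) (N : ℕ) (φ : ℝ) :
    HasDerivAt (cosSeries a N) (dcosSeries a N φ) φ := by
  refine (HasDerivAt.fun_sum fun n _ => ?_).const_add _
  refine ((hasDerivAt_ccos_mul ((n : ℂ) + 1) φ).const_mul _).congr_deriv ?_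
  ring

theorem sq_sub_succ_sq_ne_zero {a : ℂ} (ha : ∀ m : ℤ, a ≠ m) (n : ℕ) :
    a ^ 2 - ((n : ℂ) + 1) ^ 2 ≠ 0 := by
  have h1 := sub_natCast_ne_zero ha (n + 1)
  have h2 := add_natCast_ne_zero ha (n + 1)
  push_cast at h1 h2
  rw [sq_sub_sq]
  exact mul_ne_zero h2 h1

theorem hasDerivAt_dcosSeries {a : ℂ} (ha : ∀ m : ℤ, a ≠ m) (N : ℕ) (φ : ℝ) :
    HasDerivAt (fun s => dcosSeries a N s - sawtooth N s) (-a ^ 2 * cosSeries a N φ) φ := by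
  have ha0 : a ≠ 0 := by simpa using ha 0
  have h : HasDerivAt (dcosSeries a N) _ φ :=
    HasDerivAt.fun_sum fun n _ => (hasDerivAt_csin_mul ((n : ℂ) + 1) φ).const_mul _
  refine (h.sub (hasDerivAt_sawtooth N φ).ofReal_comp).congr_deriv ?_
  rw [altDirichlet, cosSeries, mul_add, Finset.mul_sum]
  push_cast
  rw [sub_add_eq_sub_sub_swap, ← Finset.sum_sub_distrib, sub_eq_neg_add]
  congr 1
  · field_simp
  · refine Finset.sum_congr rfl fun n _ => ?_
    have := sq_sub_succ_sq_ne_zero ha n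
    field_simp
    ring

theorem tendsto_cosSeries_zero {a : ℂ} (ha : ∀ m : ℤ, a ≠ m) :
    Tendsto (fun N => cosSeries a N 0) atTop
      (nhds (Real.pi / (a * Complex.sin (Real.pi * a)))) := by
  have ha0 : a ≠ 0 := by simpa using ha 0
  have h := ((tendsto_csc_series ha).const_add (1 / a)).const_mul (1 / a)
  rw [add_sub_cancel] at h
  convert h using 2 with N
  · rw [cosSeries, mul_add, Finset.mul_sum]
    congr 1
    · field_simp
    · refine Finset.sum_congr rfl fun n _ => ?_
      have h0 := sq_sub_succ_sq_ne_zero ha n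
      have h1 := sub_natCast_ne_zero ha (n + 1)
      have h2 := add_natCast_ne_zero ha (n + 1)
      push_cast at h1 h2
      simp only [cotTerm, Complex.ofReal_zero, mul_zero, Complex.cos_zero]
      rw [sq_sub_sq]
      field_simp
      ring
  · rw [one_div_mul_eq_div, div_div, mul_comm]

theorem tendsto_dcosSeries {a : ℂ} (ha : ∀ m : ℤ, a ≠ m) {φ : ℝ} (h0 : 0 ≤ φ)
    (hpi : φ < Real.pi) :
    Tendsto (fun N => dcosSeries a N φ) atTop
      (nhds (-(Real.pi * Complex.sin (a * φ) / Complex.sin (Real.pi * a)))) := by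
  have ha0 : a ≠ 0 := by simpa using ha 0
  set K : ℝ := (Real.cos (φ / 2))⁻¹ + φ * ((Real.cos (φ / 2))⁻¹) ^ 2
  set δ : ℕ → ℝ := fun N => ((N : ℝ) + 1 / 2)⁻¹ * K with hδ
  have hδlim : Tendsto δ atTop (nhds 0) := by
    have : Tendsto (fun N : ℕ => (N : ℝ) + 1 / 2) atTop atTop :=
      tendsto_atTop_add_const_right _ _ tendsto_natCast_atTop_atTop
    have h := this.inv_tendsto_atTop.mul_const K
    rwa [zero_mul] at h
  have hsaw : ∀ N, ∀ t ∈ Set.Icc 0 φ, |sawtooth N t| ≤ δ N := fun N t ht =>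
    abs_sawtooth_le hpi ht N
  have hstab := fun N => harmonic_stability (a := a) (ε := δ N * φ) h0
    (u := fun s => cosSeries a N s - cosSeries a N 0 * Complex.cos (a * s))
    (u' := fun s => dcosSeries a N s - cosSeries a N 0 * -(a * Complex.sin (a * s)))
    (r := fun s => sawtooth N s) (R := fun s => sawtoothPrim N s)
    (fun t _ => (hasDerivAt_cosSeries a N t).sub ((hasDerivAt_ccos_mul a t).const_mul _))
    (fun t _ => by
      have h := (hasDerivAt_dcosSeries ha N t).sub
        (((hasDerivAt_csin_mul a t).const_mul a).neg.const_mul (cosSeries a N 0))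
      refine (h.congr_deriv ?_).congr_of_eventuallyEq (Eventually.of_forall fun x => ?_)
      · ring
      · simp only [Pi.sub_apply, Pi.neg_apply]
        ring)
    (by simp) (by simp [dcosSeries, sawtooth])
    (fun t _ => (hasDerivAt_sawtoothPrim N t).ofReal_comp) (by simp [sawtoothPrim])
    (fun t ht => by
      rw [Complex.norm_real]
      exact abs_sawtoothPrim_le ht (hsaw N)) φ ⟨h0, le_rfl⟩
  have h1 := squeeze_zero_norm (fun N => (hstab N).2)
    (by simpa using ((((hδlim.mul_const φ).const_mul 2).mul_const _).const_mul _).mul_const φ)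
  have h2 : Tendsto (fun N => (sawtooth N φ : ℂ)) atTop (nhds 0) :=
    squeeze_zero_norm (fun N => by
      rw [Complex.norm_real]
      exact hsaw N φ ⟨h0, le_rfl⟩) hδlim
  have h3 := (h1.add h2).add
    ((tendsto_cosSeries_zero ha).mul_const (-(a * Complex.sin (a * φ))))
  convert h3 using 2 with N
  · ring
  · field_simp
    ring

/-! ### The three dimensions -/

theorem Gamma_ne_zero_of_add_natCast {s : ℂ} (hs : ∀ n : ℕ, s + n ≠ 0) : Complex.Gamma s ≠ 0 :=
  Complex.Gamma_ne_zero fun n h => hs n (by rw [h, neg_add_cancel])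

theorem natCast_add_one_add_natCast_ne_zero (l n : ℕ) : (l : ℂ) + 1 + n ≠ 0 := by
  exact_mod_cast (by omega : l + 1 + n ≠ 0)

theorem add_one_add_natCast_ne_zero_of_forall_int {ν : ℂ} (hν : ∀ m : ℤ, ν ≠ m) (n : ℕ) :
    ν + 1 + n ≠ 0 := by
  have h := add_natCast_ne_zero hν (n + 1)
  push_cast at h
  rwa [add_right_comm, add_assoc]

theorem legP_three {ν : ℂ} (hν : ∀ n : ℕ, ν + 1 + n ≠ 0) (z : ℂ) :
    legP z ν 3 = F21 (-ν) (ν + 1) 1 ((1 - z) / 2) := by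
  have hG := Gamma_ne_zero_of_add_natCast hν
  have e1 : ν + (3 : ℕ) - 2 = ν + 1 := by
    push_cast
    ring
  have e2 : ((3 : ℕ) : ℂ) - 1 = 2 := by norm_num
  have e3 : Complex.Gamma 2 = 1 := by
    have := Complex.Gamma_nat_eq_factorial 1
    rwa [Nat.cast_one, one_add_one_eq_two, Nat.factorial_one, Nat.cast_one] at this
  rw [legP, e1, e2, e3, mul_one, div_self hG, one_mul, div_self two_ne_zero]

theorem legP_four {ν : ℂ} (hν : ∀ n : ℕ, ν + 1 + n ≠ 0) (z : ℂ) :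
    legP z ν 4 = (ν + 1) / 2 * F21 (-ν) (ν + 2) (3 / 2) ((1 - z) / 2) := by
  have hG := Gamma_ne_zero_of_add_natCast hν
  have h1 : ν + 1 ≠ 0 := by simpa using hν 0
  have e1 : ν + (4 : ℕ) - 2 = ν + 2 := by
    push_cast
    ring
  have e2 : ((4 : ℕ) : ℂ) - 1 = 3 := by norm_num
  have e3 : Complex.Gamma (ν + 2) = (ν + 1) * Complex.Gamma (ν + 1) := by
    rw [← Complex.Gamma_add_one _ h1, add_assoc, one_add_one_eq_two]
  have e4 : Complex.Gamma 3 = 2 := by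
    have := Complex.Gamma_nat_eq_factorial 2
    rwa [show ((2 : ℕ) : ℂ) + 1 = 3 by norm_num, Nat.factorial_two] at this
  rw [legP, e1, e2, e3, e4]
  congr 1
  field_simp

theorem legP_five {ν : ℂ} (hν : ∀ n : ℕ, ν + 1 + n ≠ 0) (z : ℂ) :
    legP z ν 5 = (ν + 1) * (ν + 2) / 6 * F21 (-ν) (ν + 3) 2 ((1 - z) / 2) := by
  have hG := Gamma_ne_zero_of_add_natCast hν
  have h1 : ν + 1 ≠ 0 := by simpa using hν 0
  have h2 : ν + 2 ≠ 0 := by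
    have := hν 1
    rwa [Nat.cast_one, add_assoc, one_add_one_eq_two] at this
  have e1 : ν + (5 : ℕ) - 2 = ν + 3 := by
    push_cast
    ring
  have e2 : ((5 : ℕ) : ℂ) - 1 = 4 := by norm_num
  have e3 : Complex.Gamma (ν + 3) = (ν + 2) * ((ν + 1) * Complex.Gamma (ν + 1)) := by
    rw [← Complex.Gamma_add_one _ h1, add_assoc ν, one_add_one_eq_two,
      ← Complex.Gamma_add_one _ h2, add_assoc ν]
    norm_num
  have e4 : Complex.Gamma 4 = 6 := by
    have := Complex.Gamma_nat_eq_factorial 3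
    rwa [show ((3 : ℕ) : ℂ) + 1 = 4 by norm_num, show Nat.factorial 3 = 6 from rfl] at this
  rw [legP, e1, e2, e3, e4, show (4 : ℂ) / 2 = 2 by norm_num]
  congr 1
  field_simp

theorem half_one_add_mem {z : ℝ} (hz : z ∈ Set.Ioo (-1 : ℝ) 1) :
    (1 + z) / 2 ∈ Set.Ioo (0 : ℝ) 1 := by
  constructor <;> linarith [hz.1, hz.2]

theorem dougall_three {ν : ℂ} (hν : ∀ m : ℤ, ν ≠ m) {z : ℝ} (hz : z ∈ Set.Ioo (-1 : ℝ) 1) :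
    Tendsto (fun N : ℕ => ∑ l ∈ Finset.range N,
        (2 * (l : ℂ) + 1) * legP z l 3 / (ν * (ν + 1) - l * (l + 1))) atTop
      (nhds (Real.pi / Complex.sin (Real.pi * ν) * legP (-z) ν 3)) := by
  have h := (tendsto_legS hν (half_one_add_mem hz)).1
  rw [legP_three (add_one_add_natCast_ne_zero_of_forall_int hν), ← tendsto_add_atTop_iff_nat 1]
  push_cast at h
  rw [sub_neg_eq_add]
  refine h.congr fun N => Finset.sum_congr rfl fun l _ => ?_
  have h1 := (legQ_eq_F21 l (t := 1 - (1 + z) / 2) (by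
    constructor <;> linarith [hz.1, hz.2])).1
  rw [legQ_one_sub] at h1
  push_cast at h1
  rw [legP_three (natCast_add_one_add_natCast_ne_zero l),
    show (1 - (z : ℂ)) / 2 = 1 - (1 + z) / 2 by ring, ← h1]
  ring

theorem dougall_five {ν : ℂ} (hν : ∀ m : ℤ, ν ≠ m) {z : ℝ} (hz : z ∈ Set.Ioo (-1 : ℝ) 1) :
    Tendsto (fun N : ℕ => ∑ l ∈ Finset.range N,
        (2 * (l : ℂ) + 3) * legP z l 5 / (ν * (ν + 3) - l * (l + 3))) atTop
      (nhds (Real.pi / Complex.sin (Real.pi * ν) * legP (-z) ν 5)) := by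
  have hν1 : ∀ m : ℤ, ν + 1 ≠ m := fun m h => hν (m - 1) (by
    push_cast
    linear_combination h)
  have h := ((tendsto_legS hν1 (half_one_add_mem hz)).2).div_const 6
  rw [legP_five (add_one_add_natCast_ne_zero_of_forall_int hν), sub_neg_eq_add]
  convert h using 2 with N
  · rw [dlegS, Finset.sum_range_succ']
    simp only [dlegQ, Complex.ofReal_zero, mul_zero, add_zero, Finset.sum_div]
    refine Finset.sum_congr rfl fun l _ => ?_
    have h1 := (legQ_eq_F21 (l + 1) (t := 1 - (1 + z) / 2) (by
      constructor <;> linarith [hz.1, hz.2])).2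
    rw [dlegQ_one_sub] at h1
    push_cast at h1
    rw [show (1 : ℂ) - (l + 1) = -l by ring, show (l : ℂ) + 1 + 2 = l + 3 by ring,
      show (1 : ℂ) - (1 + z) / 2 = (1 - z) / 2 by ring] at h1
    rw [legP_five (natCast_add_one_add_natCast_ne_zero l)]
    have hd : (ν + 1) * (ν + 1 + 1) - ((l + 1 : ℕ) : ℂ) * ((l + 1 : ℕ) + 1) =
        ν * (ν + 3) - l * (l + 3) := by
      push_cast
      ring
    rw [hd]
    push_cast
    linear_combination ((2 * (l : ℂ) + 3) / 6 / (ν * (ν + 3) - l * (l + 3))) * h1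
  · rw [mul_add_one (Real.pi : ℂ), Complex.sin_add_pi, show (1 : ℂ) - (ν + 1) = -ν by ring,
      show ν + 1 + 2 = ν + 3 by ring]
    push_cast
    rw [div_neg]
    ring

theorem dougall_four {ν : ℂ} (hν : ∀ m : ℤ, ν ≠ m) {z : ℝ} (hz : z ∈ Set.Ioo (-1 : ℝ) 1) :
    Tendsto (fun N : ℕ => ∑ l ∈ Finset.range N,
        (2 * (l : ℂ) + 2) * legP z l 4 / (ν * (ν + 2) - l * (l + 2))) atTop
      (nhds (Real.pi / Complex.sin (Real.pi * ν) * legP (-z) ν 4)) := by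
  have hν1 : ∀ m : ℤ, ν + 1 ≠ m := fun m h => hν (m - 1) (by
    push_cast
    linear_combination h)
  obtain ⟨φ, hφ0, hφpi, hcos⟩ : ∃ φ, 0 < φ ∧ φ < Real.pi ∧ Real.cos φ = -z :=
    ⟨Real.arccos (-z), Real.arccos_pos.mpr (by linarith [hz.1]),
      (Real.arccos_le_pi _).lt_of_ne fun h => by
        rw [Real.arccos_eq_pi] at h
        linarith [hz.2], Real.cos_arccos (by linarith [hz.2]) (by linarith [hz.1])⟩
  have hz' : (z : ℂ) = -Complex.cos φ := by
    rw [← Complex.ofReal_cos, hcos, Complex.ofReal_neg, neg_neg]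
  have hsin : Complex.sin φ ≠ 0 := by
    rw [← Complex.ofReal_sin]
    exact_mod_cast (Real.sin_pos_of_pos_of_lt_pi hφ0 hφpi).ne'
  have hU := F21_three_half_mul_sin ν hφ0.le hφpi
  rw [legP_four (add_one_add_natCast_ne_zero_of_forall_int hν), hz', neg_neg]
  convert (tendsto_dcosSeries hν1 hφ0.le hφpi).div_const (2 * Complex.sin φ) using 2 with N
  · rw [dcosSeries, Finset.sum_div]
    refine Finset.sum_congr rfl fun l _ => ?_
    have hl := F21_three_half_mul_sin l (sub_nonneg.mpr hφpi.le) (sub_lt_self Real.pi hφ0)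
    have hs : Complex.sin (((l : ℂ) + 1) * (Real.pi - φ)) =
        (-1) ^ l * Complex.sin ((l + 1) * φ) := by
      have h1 : ((l : ℂ) + 1) * (Real.pi - φ) =
          ((l + 1 : ℕ) : ℂ) * Real.pi - (l + 1) * φ := by
        push_cast
        ring
      have h2 : Complex.cos (((l + 1 : ℕ) : ℂ) * Real.pi) = (-1) ^ (l + 1) := by
        exact_mod_cast congrArg Complex.ofReal (Real.cos_nat_mul_pi (l + 1))
      rw [h1, Complex.sin_sub, Complex.sin_nat_mul_pi, h2]
      ring
    push_cast at hl
    rw [hs, Complex.cos_pi_sub, Complex.sin_pi_sub] at hl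
    rw [legP_four (natCast_add_one_add_natCast_ne_zero l)]
    have hd : (ν + 1) ^ 2 - ((l : ℂ) + 1) ^ 2 = ν * (ν + 2) - l * (l + 2) := by ring
    have hd0 := sq_sub_succ_sq_ne_zero hν1 l
    rw [hd] at hd0 ⊢
    field_simp
    linear_combination hl
  · have hs : Complex.sin (Real.pi * ν) ≠ 0 := sin_pi_mul_ne_zero (mem_integerComplement hν)
    rw [mul_add_one (Real.pi : ℂ), Complex.sin_add_pi]
    field_simp
    linear_combination hU

/-- Generalized Dougall formula: for `D ∈ {3,4,5}`, `ν ∈ ℂ \ ℤ`, `z ∈ (-1,1)`,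
the series `Σ_{l} (2l+D-2)·P(z,l,D)/(ν(ν+D-2) - l(l+D-2))` converges to
`(π/sin(πν))·P(-z,ν,D)`. -/
theorem stmt0 (D : ℕ) (hD : D = 3 ∨ D = 4 ∨ D = 5) (ν : ℂ) (hν : ∀ m : ℤ, ν ≠ m)
    (z : ℝ) (hz : z ∈ Set.Ioo (-1 : ℝ) 1) :
    Tendsto (fun N : ℕ => ∑ l ∈ Finset.range N,
        (2 * (l : ℂ) + D - 2) * legP (z : ℂ) (l : ℂ) D /
          (ν * (ν + D - 2) - l * ((l : ℂ) + D - 2)))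
      atTop
      (nhds ((Real.pi : ℂ) / Complex.sin (Real.pi * ν) * legP (-(z : ℂ)) ν D)) := by
  rcases hD with rfl | rfl | rfl
  · convert dougall_three hν hz using 5 <;> push_cast <;> ring
  · convert dougall_four hν hz using 5 <;> push_cast <;> ring
  · convert dougall_five hν hz using 5 <;> push_cast <;> ring
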